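/- arXiv:math/0402216 — 3 statements merged into one kernel-verified Lean document; each statement's English description precedes it below -/
import Mathlib

section
/- Let T : V_j → V_j be a Σ_N-equivariant linear map for the representation π_j(σ)(τ) = S(σ,τ)·στσ⁻¹ on the vector space V_j with basis X_j (involutions with j transpositions). Then the matrix of T with respect to the basis X_j is symmetric: T^τ_{τ′} = T^{τ′}_τ for all τ, τ′ ∈ X_j. -/
open Equiv Finset

def Ssign {N : ℕ} (σ τ : Equiv.Perm (Fin N)) : ℤ :=
  (-1) ^ (Finset.univ.filter (fun p : Fin N × Fin N =>
      p.1 < p.2 ∧ τ p.1 = p.2 ∧ σ p.2 < σ p.1)).card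

/-- The set of involutions of Σ_N that are products of j disjoint transpositions. -/
def InvolJ (N j : ℕ) : Type := {τ : Equiv.Perm (Fin N) // τ * τ = 1 ∧ τ.support.card = 2 * j}

instance (N j : ℕ) : Fintype (InvolJ N j) := by unfold InvolJ; infer_instance
instance (N j : ℕ) : DecidableEq (InvolJ N j) := by unfold InvolJ; infer_instance

/-- Conjugation of an involution of length j by σ. -/
def involConj {N j : ℕ} (σ : Equiv.Perm (Fin N)) (τ : InvolJ N j) : InvolJ N j :=
  ⟨σ * τ.1 * σ⁻¹,
   by rw [show σ * τ.1 * σ⁻¹ * (σ * τ.1 * σ⁻¹) = σ * (τ.1 * τ.1) * σ⁻¹ by group, τ.2.1]; simp,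
   by rw [Equiv.Perm.support_conj]; simp [τ.2.2]⟩

/-- The representation π_j of Σ_N on the free vector space V_j with basis X_j,
given on basis vectors by π_j(σ)(τ) = S(σ,τ)·στσ⁻¹; here V_j is realized as the
space of ℂ-valued functions on X_j, with δ_τ as basis. -/
noncomputable def piRep (N j : ℕ) (σ : Equiv.Perm (Fin N)) :
    (InvolJ N j → ℂ) →ₗ[ℂ] (InvolJ N j → ℂ) where
  toFun f := fun κ => (Ssign σ (involConj σ⁻¹ κ).1 : ℂ) * f (involConj σ⁻¹ κ)
  map_add' := by intro f g; funext κ; simp [mul_add]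
  map_smul' := by intro c f; funext κ; simp; ring

/-- π_j(σ) sends the basis vector δ_τ to S(σ,τ)·δ_{στσ⁻¹}. -/
theorem piRep_single (N j : ℕ) (σ : Equiv.Perm (Fin N)) (τ : InvolJ N j) :
    piRep N j σ (Pi.single τ 1 : InvolJ N j → ℂ) =
      (Ssign σ τ.1 : ℂ) • (Pi.single (involConj σ τ) 1 : InvolJ N j → ℂ) := by
  have key : ∀ κ : InvolJ N j, involConj σ⁻¹ κ = τ ↔ κ = involConj σ τ := by
    intro κ
    constructor <;> intro h
    · rw [← h]; apply Subtype.ext; simp [involConj, mul_assoc]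
    · rw [h]; apply Subtype.ext; simp [involConj, mul_assoc]
  funext κ
  by_cases hκ : κ = involConj σ τ
  · subst hκ
    have h3 : involConj σ⁻¹ (involConj σ τ) = τ := (key _).2 rfl
    simp only [piRep, LinearMap.coe_mk, AddHom.coe_mk, Pi.smul_apply, smul_eq_mul,
      Pi.single_eq_same, mul_one]
    rw [h3, Pi.single_eq_same, mul_one]
  · have h2 : involConj σ⁻¹ κ ≠ τ := fun h => hκ ((key κ).1 h)
    simp [piRep, Pi.single_eq_of_ne hκ, Pi.single_eq_of_ne h2]

/-- A pair of involutions `s`, `t` together with the powers `G n` of `t ∘ s`. -/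
structure Dih {α : Type*} (s t : α → α) (G : ℤ → α → α) : Prop where
  ss : ∀ x, s (s x) = x
  add : ∀ a b x, G a (G b x) = G (a + b) x
  zero : ∀ x, G 0 x = x
  sG : ∀ n x, s (G n x) = G (-n) (s x)
  t1 : ∀ x, t x = G 1 (s x)

namespace Dih

variable {α : Type*} {s t : α → α} {G : ℤ → α → α}

theorem tt (D : Dih s t G) (x : α) : t (t x) = x := by
  rw [D.t1, D.t1, D.sG, D.ss, D.add]; exact D.zero x

theorem tG (D : Dih s t G) (n : ℤ) (x : α) : t (G n x) = G (1 - n) (s x) := by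
  rw [D.t1, D.sG, D.add]; rfl

theorem eq_iff (D : Dih s t G) (a b : ℤ) (x y : α) : G a x = G b y ↔ G (a - b) x = y := by
  constructor
  · intro h
    have := congrArg (G (-b)) h
    rw [D.add, D.add, neg_add_cancel, D.zero] at this
    rw [← this]; congr 1; ring
  · rintro rfl
    rw [D.add]; congr 1; ring

theorem symm (D : Dih s t G) : Dih t s (fun n => G (-n)) where
  ss := D.tt
  add a b x := by rw [D.add]; congr 1; ring
  zero x := by simpa using D.zero x
  sG n x := by rw [D.tG, D.t1, D.add]; congr 1; ring
  t1 x := by rw [D.t1, D.add]; simp [D.zero]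

/-- same orbit -/
def rel (s : α → α) (G : ℤ → α → α) (x y : α) : Prop := ∃ n : ℤ, y = G n x ∨ y = G n (s x)

theorem rel_equiv (D : Dih s t G) : Equivalence (rel s G) where
  refl x := ⟨0, Or.inl (D.zero x).symm⟩
  symm := by
    rintro x y ⟨n, rfl | rfl⟩
    · exact ⟨-n, Or.inl (by rw [D.add]; simp [D.zero])⟩
    · exact ⟨n, Or.inr (by rw [D.sG, D.ss, D.add]; simp [D.zero])⟩
  trans := by
    rintro x y z ⟨n, rfl | rfl⟩ ⟨m, rfl | rfl⟩
    · exact ⟨m + n, Or.inl (D.add _ _ _)⟩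
    · exact ⟨m - n, Or.inr (by rw [D.sG, D.add]; rfl)⟩
    · exact ⟨m + n, Or.inr (D.add _ _ _)⟩
    · exact ⟨m - n, Or.inl (by rw [D.sG, D.ss, D.add]; rfl)⟩

def good (s : α → α) (G : ℤ → α → α) (y : α) : Prop := ∀ n : ℤ, s y = G n y → G (2 * n + 1) y = y

def bad (s : α → α) (G : ℤ → α → α) (x : α) : Prop :=
  s x = x ∧ ∃ h : ℤ, 0 < h ∧ ∀ n : ℤ, G n x = x ↔ 2 * h ∣ n

theorem dich (D : Dih s t G) (hper : ∀ x, ∃ m : ℤ, 0 < m ∧ ∀ n : ℤ, G n x = x ↔ m ∣ n) (z : α) :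
    (∃ y, rel s G z y ∧ good s G y) ∨ (∃ x, bad s G x) ∨ (∃ x, bad t (fun n => G (-n)) x) := by
  by_cases hz : ∃ n : ℤ, s z = G n z
  · obtain ⟨n, hn⟩ := hz
    have hx : ∃ x, rel s G z x ∧ (s x = x ∨ t x = x) := by
      obtain ⟨k, rfl | rfl⟩ := n.even_or_odd'
      · refine ⟨G k z, ⟨k, Or.inl rfl⟩, Or.inl ?_⟩
        rw [D.sG, hn, D.add]; congr 1; ring
      · refine ⟨G (k+1) z, ⟨k+1, Or.inl rfl⟩, Or.inr ?_⟩
        rw [D.tG, hn, D.add]; congr 1; ring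
    obtain ⟨x, hzx, hx⟩ := hx
    obtain ⟨m, hm, hmx⟩ := hper x
    obtain ⟨k, rfl | rfl⟩ := m.even_or_odd'
    · right
      rcases hx with hx | hx
      · exact Or.inl ⟨x, hx, k, by omega, hmx⟩
      · exact Or.inr ⟨x, hx, k, by omega, fun n => by simp [hmx]⟩
    · left
      have key : ∀ e : ℤ, ∃ c : ℤ, 2 * k + 1 ∣ 4 * c - e := by
        intro e
        -- inverse of 4 is (k+1)^2
        exact ⟨e * (k+1)^2, e * (2*k+3), by ring⟩
      rcases hx with hx | hx
      · obtain ⟨c, hc⟩ := key 1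
        refine ⟨G c x, D.rel_equiv.trans hzx ⟨c, Or.inl rfl⟩, fun n hn => ?_⟩
        rw [D.sG, hx, D.add, D.eq_iff, hmx] at hn
        rw [D.add, D.eq_iff, hmx]
        have := dvd_add (hn.mul_left (-2)) (hc.mul_left (-1))
        obtain ⟨d, hd⟩ := this
        exact ⟨d, by linear_combination hd⟩
      · obtain ⟨c, hc⟩ := key (-1)
        have hsx : s x = G (-1) x := by
          rw [D.t1] at hx
          have := (D.eq_iff 1 0 (s x) x).1 (by rw [hx, D.zero])
          conv_rhs => rw [← hx]
          rw [D.add]; simp [D.zero]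
        refine ⟨G c x, D.rel_equiv.trans hzx ⟨c, Or.inl rfl⟩, fun n hn => ?_⟩
        rw [D.sG, hsx, D.add, D.add, D.eq_iff, hmx] at hn
        rw [D.add, D.eq_iff, hmx]
        have := dvd_add (hn.mul_left (-2)) (hc.mul_left (-1))
        obtain ⟨d, hd⟩ := this
        exact ⟨d, by linear_combination hd⟩
  · left
    exact ⟨z, D.rel_equiv.refl z, fun n hn => absurd ⟨n, hn⟩ hz⟩

/-- the reflection about `y` -/
def R (s : α → α) (G : ℤ → α → α) (y z w : α) : Prop :=
  ∃ n : ℤ, (z = G n y ∧ w = G (-n) y) ∨ (z = G n (s y) ∧ w = G (1 + n - 2 * n) (s y))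

theorem R_total {y z : α} (h : rel s G y z) : ∃ w, R s G y z w := by
  obtain ⟨n, h | h⟩ := h
  · exact ⟨_, n, Or.inl ⟨h, rfl⟩⟩
  · exact ⟨_, n, Or.inr ⟨h, rfl⟩⟩

theorem R_symm {y z w : α} (h : R s G y z w) : R s G y w z := by
  obtain ⟨n, ⟨rfl, rfl⟩ | ⟨rfl, rfl⟩⟩ := h
  · exact ⟨-n, Or.inl ⟨rfl, by simp⟩⟩
  · exact ⟨1 - n, Or.inr ⟨by congr 1; ring, by congr 1; ring⟩⟩

theorem R_st (D : Dih s t G) {y z w : α} (h : R s G y z w) : R s G y (s z) (t w) := by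
  obtain ⟨n, ⟨rfl, rfl⟩ | ⟨rfl, rfl⟩⟩ := h
  · exact ⟨-n, Or.inr ⟨D.sG _ _, by rw [D.tG]; congr 1; ring⟩⟩
  · exact ⟨-n, Or.inl ⟨by rw [D.sG, D.ss], by rw [D.tG, D.ss]; congr 1; ring⟩⟩

theorem R_func (D : Dih s t G) {y z w w' : α} (hy : good s G y) (h : R s G y z w)
    (h' : R s G y z w') : w = w' := by
  have neg : ∀ (k : ℤ) (x : α), G k x = x → G (-k) x = x := by
    intro k x h
    conv_lhs => rw [← h]
    rw [D.add]; simp [D.zero]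
  have key : ∀ n m : ℤ, G n y = G m (s y) → G (-n) y = G (1 + m - 2 * m) (s y) := by
    intro n m e
    rw [D.eq_iff] at e
    have h2 := hy _ e.symm
    rw [D.eq_iff, ← e]
    rw [D.eq_iff]
    convert neg _ _ h2 using 2; ring
  obtain ⟨n, ⟨rfl, rfl⟩ | ⟨rfl, rfl⟩⟩ := h <;> obtain ⟨m, ⟨e, rfl⟩ | ⟨e, rfl⟩⟩ := h'
  · rw [D.eq_iff] at e ⊢
    convert neg _ _ e using 2; ring
  · exact key _ _ e
  · exact (key _ _ e.symm).symm
  · rw [D.eq_iff] at e ⊢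
    convert neg _ _ e using 2; ring

theorem exists_swap (D : Dih s t G) (hg : ∀ z, ∃ y, rel s G z y ∧ good s G y) :
    ∃ σ : α → α, (∀ z, σ (σ z) = z) ∧ ∀ z, σ (s z) = t (σ z) := by
  classical
  let S : Setoid α := ⟨rel s G, D.rel_equiv⟩
  have hb : ∃ b : α → α, (∀ z, rel s G (b z) z ∧ good s G (b z)) ∧
      ∀ z w, rel s G z w → b z = b w := by
    choose f hf hf' using hg
    refine ⟨fun z => f (Quotient.mk S z).out, fun z => ⟨?_, hf' _⟩, fun z w h => ?_⟩
    · exact D.rel_equiv.trans (D.rel_equiv.symm (hf _)) (Quotient.mk_out (s := S) z)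
    · have : Quotient.mk S z = Quotient.mk S w := Quotient.sound h
      simp only [this]
  obtain ⟨b, hb, hb'⟩ := hb
  choose σ hσ using fun z => R_total (hb z).1
  have hrel : ∀ z, rel s G (b z) (σ z) := by
    intro z
    obtain ⟨n, ⟨_, h⟩ | ⟨_, h⟩⟩ := hσ z
    · exact ⟨_, Or.inl h⟩
    · exact ⟨_, Or.inr h⟩
  refine ⟨σ, fun z => ?_, fun z => ?_⟩
  · have h1 : b (σ z) = b z := hb' _ _ (D.rel_equiv.trans (D.rel_equiv.symm (hrel z)) (hb z).1)
    have h2 := hσ (σ z)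
    rw [h1] at h2
    exact D.R_func (hb z).2 h2 (R_symm (hσ z))
  · have h1 : b (s z) = b z := (hb' _ _ ⟨0, Or.inr (D.zero _).symm⟩).symm
    have h2 := hσ (s z)
    rw [h1] at h2
    exact D.R_func (hb z).2 h2 (D.R_st (hσ z))

/-- the central reflection of a bad component -/
theorem exists_flip (D : Dih s t G) {x : α} (hx : bad s G x) :
    ∃ ρ : α → α, (∀ z, ρ (ρ z) = z) ∧ (∀ z, ρ (s z) = s (ρ z)) ∧ (∀ z, ρ (t z) = t (ρ z)) ∧
     ((∃ a, s a ≠ a ∧ (∀ z, ρ z = s z ∧ s z ≠ z ↔ z = a ∨ z = s a) ∧ ∀ z, ρ z = t z → t z = z) ∨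
      (∃ a, t a ≠ a ∧ (∀ z, ρ z = t z ∧ t z ≠ z ↔ z = a ∨ z = t a) ∧ ∀ z, ρ z = s z → s z = z))
      := by
  classical
  obtain ⟨hs, h, hh, hp⟩ := hx
  have e : ∀ a b : ℤ, G a x = G b x ↔ 2 * h ∣ a - b := fun a b => by rw [D.eq_iff, hp]
  let O : α → Prop := fun z => ∃ n : ℤ, z = G n x
  have Os : ∀ z, O z → O (s z) := by
    rintro _ ⟨n, rfl⟩; exact ⟨-n, by rw [D.sG, hs]⟩
  have Os' : ∀ z, O (s z) ↔ O z := fun z => ⟨fun h => by simpa [D.ss] using Os _ h, Os z⟩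
  have Ot : ∀ z, O z → O (t z) := by
    rintro _ ⟨n, rfl⟩; exact ⟨1-n, by rw [D.tG, hs]⟩
  have Ot' : ∀ z, O (t z) ↔ O z := fun z => ⟨fun h => by simpa [D.tt] using Ot _ h, Ot z⟩
  let ρ : α → α := fun z => if O z then G h z else z
  have ρO : ∀ n : ℤ, ρ (G n x) = G (h + n) x := fun n => by
    have : O (G n x) := ⟨n, rfl⟩
    simp only [ρ, if_pos this, D.add]
  have ρN : ∀ z, ¬ O z → ρ z = z := fun z hz => by simp only [ρ, if_neg hz]
  have sO : ∀ n : ℤ, s (G n x) = G (-n) x := fun n => by rw [D.sG, hs]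
  have tO : ∀ n : ℤ, t (G n x) = G (1-n) x := fun n => by rw [D.tG, hs]
  refine ⟨ρ, ?_, ?_, ?_, ?_⟩
  · intro z
    by_cases hz : O z
    · obtain ⟨n, rfl⟩ := hz
      rw [ρO, ρO, e]; exact ⟨1, by ring⟩
    · rw [ρN z hz, ρN z hz]
  · intro z
    by_cases hz : O z
    · obtain ⟨n, rfl⟩ := hz
      rw [sO, ρO, ρO, sO, e]; exact ⟨1, by ring⟩
    · rw [ρN z hz, ρN _ (by rwa [Os'])]
  · intro z
    by_cases hz : O z
    · obtain ⟨n, rfl⟩ := hz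
      rw [tO, ρO, ρO, tO, e]; exact ⟨1, by ring⟩
    · rw [ρN z hz, ρN _ (by rwa [Ot'])]
  · obtain ⟨k, hk | hk⟩ := h.even_or_odd'
    · left
      refine ⟨G k x, ?_, ?_, ?_⟩
      · rw [sO, Ne, e]
        rintro ⟨c, hc⟩
        have : k * (2 * c + 1) * 2 = 0 := by rw [hk] at hc; linear_combination -hc
        have : k * (2 * c + 1) = 0 := by omega
        rcases mul_eq_zero.1 this with h | h <;> omega
      · intro z
        constructor
        · rintro ⟨h1, h2⟩
          by_cases hz : O z
          · obtain ⟨n, rfl⟩ := hz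
            rw [ρO, sO, e] at h1
            obtain ⟨c, hc⟩ := h1
            rw [sO, e, e]
            have hn : n = h * c - k := by linarith
            obtain ⟨d, rfl | rfl⟩ := c.even_or_odd'
            · right; exact ⟨d, by rw [hn]; ring⟩
            · left; exact ⟨d, by rw [hn]; linear_combination hk⟩
          · rw [ρN z hz] at h1; exact absurd h1.symm h2
        · have aux : ∀ n : ℤ, (n = k ∨ n = -k) → ρ (G n x) = s (G n x) ∧ s (G n x) ≠ G n x := by
            intro n hn
            constructor
            · rw [ρO, sO, e]
              rcases hn with rfl | rfl
              · exact ⟨1, by linarith⟩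
              · exact ⟨0, by linarith⟩
            · rw [sO, Ne, e]
              rintro ⟨c, hc⟩
              have : k * (2 * c + 1) = 0 ∨ k * (2 * c - 1) = 0 := by
                rw [hk] at hc
                rcases hn with rfl | rfl
                · left; linarith
                · right; linarith
              rcases this with this | this <;> rcases mul_eq_zero.1 this with h | h <;> omega
          rintro (rfl | rfl)
          · exact aux k (Or.inl rfl)
          · rw [sO]; exact aux (-k) (Or.inr rfl)
      · intro z h1
        by_cases hz : O z
        · obtain ⟨n, rfl⟩ := hz
          rw [ρO, tO, e] at h1
          obtain ⟨c, hc⟩ := h1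
          exfalso
          rw [mul_assoc] at hc
          omega
        · rw [ρN z hz] at h1; exact h1.symm
    · right
      refine ⟨G (k+1) x, ?_, ?_, ?_⟩
      · rw [tO, Ne, e]
        rintro ⟨c, hc⟩
        have : (2 * k + 1) * (2 * c + 1) = 0 := by rw [hk] at hc; linear_combination -hc
        rcases mul_eq_zero.1 this with h | h <;> omega
      · intro z
        constructor
        · rintro ⟨h1, h2⟩
          by_cases hz : O z
          · obtain ⟨n, rfl⟩ := hz
            rw [ρO, tO, e] at h1
            obtain ⟨c, hc⟩ := h1
            rw [tO, e, e]
            have hn : n = h * c - k := by linarith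
            obtain ⟨d, rfl | rfl⟩ := c.even_or_odd'
            · right; exact ⟨d, by rw [hn]; ring⟩
            · left; exact ⟨d, by rw [hn]; linear_combination hk⟩
          · rw [ρN z hz] at h1; exact absurd h1.symm h2
        · have aux : ∀ n : ℤ, (n = k + 1 ∨ n = -k) →
              ρ (G n x) = t (G n x) ∧ t (G n x) ≠ G n x := by
            intro n hn
            constructor
            · rw [ρO, tO, e]
              rcases hn with rfl | rfl
              · exact ⟨1, by linarith⟩
              · exact ⟨0, by linarith⟩
            · rw [tO, Ne, e]
              rintro ⟨c, hc⟩
              have : (2 * k + 1) * (2 * c + 1) = 0 ∨ (2 * k + 1) * (2 * c - 1) = 0 := by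
                rw [hk] at hc
                rcases hn with rfl | rfl
                · left; linarith
                · right; linarith
              rcases this with this | this <;> rcases mul_eq_zero.1 this with h | h <;> omega
          rintro (rfl | rfl)
          · exact aux (k+1) (Or.inl rfl)
          · rw [tO]; exact aux _ (Or.inr (by ring))
      · intro z h1
        by_cases hz : O z
        · obtain ⟨n, rfl⟩ := hz
          rw [ρO, sO, e] at h1
          obtain ⟨c, hc⟩ := h1
          exfalso
          rw [mul_assoc] at hc
          omega
        · rw [ρN z hz] at h1; exact h1.symm

end Dih

theorem dih_perm {N : ℕ} (s t : Equiv.Perm (Fin N)) (hs : s * s = 1) (ht : t * t = 1) :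
    Dih (s : Fin N → Fin N) t (fun n => ((t * s) ^ n : Equiv.Perm (Fin N))) := by
  have hs' : s⁻¹ = s := inv_eq_of_mul_eq_one_left hs
  have ht' : t⁻¹ = t := inv_eq_of_mul_eq_one_left ht
  refine ⟨fun x => ?_, fun a b x => ?_, fun x => ?_, fun n x => ?_, fun x => ?_⟩
  · rw [← Equiv.Perm.mul_apply, hs]; rfl
  · rw [zpow_add]; rfl
  · simp
  · rw [← Equiv.Perm.mul_apply, ← Equiv.Perm.mul_apply]
    congr 1
    have h1 : s * (t * s) ^ n * s⁻¹ = (s * (t * s) * s⁻¹) ^ n := (conj_zpow ..).symm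
    have h2 : s * (t * s) * s⁻¹ = (t * s)⁻¹ := by rw [mul_inv_rev, hs', ht', mul_assoc, mul_assoc, hs, mul_one]
    rw [h2, inv_zpow', mul_inv_eq_iff_eq_mul] at h1
    exact h1
  · simp only [zpow_one]
    rw [← Equiv.Perm.mul_apply, mul_assoc, hs, mul_one]

theorem perm_period {N : ℕ} (g : Equiv.Perm (Fin N)) (x : Fin N) :
    ∃ m : ℤ, 0 < m ∧ ∀ n : ℤ, (g ^ n) x = x ↔ m ∣ n := by
  refine ⟨Function.minimalPeriod (g • ·) x, ?_, fun n => ?_⟩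
  · have := MulAction.minimalPeriod_pos (a := g) (b := x)
    exact_mod_cast Nat.pos_of_ne_zero this.out
  · exact MulAction.zpow_smul_eq_iff_minimalPeriod_dvd (a := g) (b := x)

theorem Ssign_swap {N : ℕ} (σ s t : Equiv.Perm (Fin N)) (h2 : ∀ z, σ (σ z) = z)
    (hst : ∀ z, σ (s z) = t (σ z)) (hs : ∀ z, s (s z) = z) (ht : ∀ z, t (t z) = z) :
    Ssign σ s = Ssign σ t := by
  unfold Ssign
  congr 1
  refine Finset.card_bij' (fun p _ => (σ p.2, σ p.1)) (fun p _ => (σ p.2, σ p.1)) ?_ ?_ ?_ ?_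
  · rintro ⟨a, b⟩ h
    simp only [Finset.mem_filter, Finset.mem_univ, true_and, h2] at h ⊢
    obtain ⟨h1, rfl, h3⟩ := h
    exact ⟨h3, by rw [← hst, hs], h1⟩
  · rintro ⟨a, b⟩ h
    simp only [Finset.mem_filter, Finset.mem_univ, true_and, h2] at h ⊢
    obtain ⟨h1, rfl, h3⟩ := h
    refine ⟨h3, ?_, h1⟩
    apply σ.injective
    rw [hst, h2, ht, h2]
  · rintro ⟨a, b⟩ h; simp [h2]
  · rintro ⟨a, b⟩ h; simp [h2]

/-- Reduction of the sign to the flipped edges. -/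
theorem Ssign_flip {N : ℕ} (ρ s : Equiv.Perm (Fin N)) (h2 : ∀ z, ρ (ρ z) = z)
    (hc : ∀ z, ρ (s z) = s (ρ z)) (hs : ∀ z, s (s z) = z) :
    Ssign ρ s = (-1) ^ (Finset.univ.filter (fun z : Fin N => z < s z ∧ ρ z = s z)).card := by
  unfold Ssign
  rw [← Finset.prod_const, ← Finset.prod_const,
    ← Finset.prod_filter_mul_prod_filter_not _ (fun p : Fin N × Fin N => ρ p.1 = p.2)]
  have h1 : ∏ p ∈ (Finset.univ.filter (fun p : Fin N × Fin N =>
      p.1 < p.2 ∧ s p.1 = p.2 ∧ ρ p.2 < ρ p.1)).filter (fun p => ¬ ρ p.1 = p.2), (-1 : ℤ) = 1 := by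
    refine Finset.prod_involution (fun p _ => (ρ p.2, ρ p.1)) ?_ ?_ ?_ ?_
    · intros; norm_num
    · rintro ⟨a, b⟩ h _ h'
      simp only [Finset.mem_filter, Prod.mk.injEq] at h h'
      exact h.2 h'.2
    · rintro ⟨a, b⟩ h
      simp only [Finset.mem_filter, Finset.mem_univ, true_and, h2] at h ⊢
      obtain ⟨⟨h1, rfl, h3⟩, h4⟩ := h
      refine ⟨⟨h3, by rw [← hc, hs], h1⟩, fun h5 => h4 h5.symm⟩
    · rintro ⟨a, b⟩ h; simp [h2]
  rw [h1, mul_one, Finset.prod_const, Finset.prod_const]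
  congr 1
  refine Finset.card_bij' (fun p _ => p.1) (fun z _ => (z, s z)) ?_ ?_ ?_ ?_
  · rintro ⟨a, b⟩ h
    simp only [Finset.mem_filter, Finset.mem_univ, true_and] at h ⊢
    obtain ⟨⟨h1, rfl, h3⟩, h4⟩ := h
    exact ⟨h1, h4⟩
  · intro z h
    simp only [Finset.mem_filter, Finset.mem_univ, true_and] at h ⊢
    refine ⟨⟨h.1, ?_⟩, h.2⟩
    rw [← h.2, h2, h.2]; exact h.1
  · rintro ⟨a, b⟩ h
    simp only [Finset.mem_filter, Finset.mem_univ, true_and] at h ⊢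
    rw [h.1.2.1]
  · intros; rfl

theorem Ssign_one {N : ℕ} (ρ s : Equiv.Perm (Fin N)) (h2 : ∀ z, ρ (ρ z) = z)
    (hc : ∀ z, ρ (s z) = s (ρ z)) (hs : ∀ z, s (s z) = z) (h : ∀ z, ρ z = s z → s z = z) :
    Ssign ρ s = 1 := by
  rw [Ssign_flip ρ s h2 hc hs, Finset.filter_false_of_mem, Finset.card_empty, pow_zero]
  rintro z - ⟨h3, h4⟩
  exact h3.ne (h z h4).symm

theorem Ssign_neg {N : ℕ} (ρ s : Equiv.Perm (Fin N)) (h2 : ∀ z, ρ (ρ z) = z)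
    (hc : ∀ z, ρ (s z) = s (ρ z)) (hs : ∀ z, s (s z) = z) {a : Fin N} (ha : s a ≠ a)
    (h : ∀ z, ρ z = s z ∧ s z ≠ z ↔ z = a ∨ z = s a) :
    Ssign ρ s = -1 := by
  rw [Ssign_flip ρ s h2 hc hs]
  have : (Finset.univ.filter (fun z : Fin N => z < s z ∧ ρ z = s z)) = {min a (s a)} := by
    ext z
    simp only [Finset.mem_filter, Finset.mem_univ, true_and, Finset.mem_singleton]
    constructor
    · rintro ⟨h3, h4⟩
      rcases (h z).1 ⟨h4, h3.ne'⟩ with rfl | rfl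
      · rw [min_eq_left h3.le]
      · rw [hs] at h3; rw [min_eq_right h3.le]
    · intro hz
      rcases lt_or_gt_of_ne ha with h5 | h5
      · rw [min_eq_right h5.le] at hz
        have := (h z).2 (Or.inr hz)
        subst hz
        exact ⟨by rwa [hs], this.1⟩
      · rw [min_eq_left h5.le] at hz
        have := (h z).2 (Or.inl hz)
        subst hz
        exact ⟨h5, this.1⟩
  rw [this]; simp

theorem key_alt {N : ℕ} (s t : Equiv.Perm (Fin N)) (hs : s * s = 1) (ht : t * t = 1) :
    (∃ σ : Equiv.Perm (Fin N), σ * s * σ⁻¹ = t ∧ σ * t * σ⁻¹ = s ∧ Ssign σ s = Ssign σ t) ∨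
    (∃ ρ : Equiv.Perm (Fin N), ρ * s * ρ⁻¹ = s ∧ ρ * t * ρ⁻¹ = t ∧ Ssign ρ s ≠ Ssign ρ t) := by
  have D := dih_perm s t hs ht
  by_cases hg : ∀ z, ∃ y, Dih.rel s (fun n => ((t * s) ^ n : Equiv.Perm (Fin N))) z y ∧
      Dih.good s (fun n => ((t * s) ^ n : Equiv.Perm (Fin N))) y
  · left
    obtain ⟨f, hf, hf'⟩ := D.exists_swap hg
    obtain ⟨σ, hσ⟩ : ∃ σ : Equiv.Perm (Fin N), ∀ z, σ z = f z := ⟨⟨f, f, hf, hf⟩, fun _ => rfl⟩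
    have hf2 : ∀ z, σ (σ z) = z := by simpa only [hσ] using hf
    have hf3 : ∀ z, σ (s z) = t (σ z) := by simpa only [hσ] using hf'
    refine ⟨σ, ?_, ?_, Ssign_swap σ s t hf2 hf3 D.ss D.tt⟩
    · rw [mul_inv_eq_iff_eq_mul]; ext1 z; exact hf3 z
    · rw [mul_inv_eq_iff_eq_mul]; ext1 z
      apply σ.injective
      simp only [Equiv.Perm.mul_apply]
      rw [hf2, hf3, hf2]
  · right
    push Not at hg
    obtain ⟨z, hz⟩ := hg
    have hbad := (D.dich (perm_period (t * s)) z).resolve_left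
      (by rintro ⟨y, h1, h2⟩; exact hz y h1 h2)
    have main : ∀ u v : Equiv.Perm (Fin N), ∀ G, Dih (u : Fin N → Fin N) v G →
        (∃ x, Dih.bad u G x) → ∃ ρ : Equiv.Perm (Fin N),
          ρ * u * ρ⁻¹ = u ∧ ρ * v * ρ⁻¹ = v ∧ Ssign ρ u ≠ Ssign ρ v := by
      rintro u v G D ⟨x, hx⟩
      obtain ⟨f, hf, hfu, hfv, hh⟩ := D.exists_flip hx
      obtain ⟨ρ, hρ⟩ : ∃ ρ : Equiv.Perm (Fin N), ∀ z, ρ z = f z := ⟨⟨f, f, hf, hf⟩, fun _ => rfl⟩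
      simp only [← hρ] at hf hfu hfv hh
      refine ⟨ρ, ?_, ?_, ?_⟩
      · rw [mul_inv_eq_iff_eq_mul]; ext1 z; exact hfu z
      · rw [mul_inv_eq_iff_eq_mul]; ext1 z; exact hfv z
      · rcases hh with ⟨a, ha, h1, h2⟩ | ⟨a, ha, h1, h2⟩
        · rw [Ssign_neg ρ u hf hfu D.ss ha h1, Ssign_one ρ v hf hfv D.tt h2]; norm_num
        · rw [Ssign_neg ρ v hf hfv D.tt ha h1, Ssign_one ρ u hf hfu D.ss h2]; norm_num
    rcases hbad with hb | hb
    · exact main s t _ D hb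
    · obtain ⟨ρ, h1, h2, h3⟩ := main t s _ D.symm hb
      exact ⟨ρ, h2, h1, h3.symm⟩

theorem Ssign_ne_zero {N : ℕ} (σ τ : Equiv.Perm (Fin N)) : (Ssign σ τ : ℂ) ≠ 0 := by
  unfold Ssign; simp

theorem equivariant_entry {N j : ℕ}
    (T : (InvolJ N j → ℂ) →ₗ[ℂ] (InvolJ N j → ℂ))
    (σ : Equiv.Perm (Fin N)) (hT : T ∘ₗ piRep N j σ = piRep N j σ ∘ₗ T) (τ τ' : InvolJ N j) :
    (Ssign σ τ.1 : ℂ) * T (Pi.single (involConj σ τ) 1 : InvolJ N j → ℂ) (involConj σ τ') =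
      (Ssign σ τ'.1 : ℂ) * T (Pi.single τ 1 : InvolJ N j → ℂ) τ' := by
  have h := congrFun (LinearMap.congr_fun hT (Pi.single τ 1)) (involConj σ τ')
  have h3 : involConj σ⁻¹ (involConj σ τ') = τ' := by
    apply Subtype.ext; simp [involConj, mul_assoc]
  rw [LinearMap.comp_apply, piRep_single, map_smul, LinearMap.comp_apply] at h
  simp only [piRep, LinearMap.coe_mk, AddHom.coe_mk, Pi.smul_apply, smul_eq_mul] at h
  rw [h3] at h
  exact h

/-- The matrix of an equivariant endomorphism T of V_j with respect to the
basis X_j of involutions is symmetric: T^τ'_τ = T^τ_τ'. -/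
theorem equivariant_matrix_symm {N j : ℕ}
    (T : (InvolJ N j → ℂ) →ₗ[ℂ] (InvolJ N j → ℂ))
    (hT : ∀ σ : Equiv.Perm (Fin N), T ∘ₗ piRep N j σ = piRep N j σ ∘ₗ T) :
    ∀ τ τ' : InvolJ N j,
      T (Pi.single τ 1 : InvolJ N j → ℂ) τ' = T (Pi.single τ' 1 : InvolJ N j → ℂ) τ := by
  intro τ τ'
  rcases key_alt τ.1 τ'.1 τ.2.1 τ'.2.1 with ⟨σ, h1, h2, h3⟩ | ⟨ρ, h1, h2, h3⟩
  · have e1 : involConj σ τ = τ' := Subtype.ext h1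
    have e2 : involConj σ τ' = τ := Subtype.ext h2
    have h := equivariant_entry T σ (hT σ) τ τ'
    rw [e1, e2, h3] at h
    exact (mul_left_cancel₀ (Ssign_ne_zero _ _) h).symm
  · have e1 : involConj ρ τ = τ := Subtype.ext h1
    have e2 : involConj ρ τ' = τ' := Subtype.ext h2
    have h := equivariant_entry T ρ (hT ρ) τ τ'
    have h' := equivariant_entry T ρ (hT ρ) τ' τ
    rw [e1, e2] at h h'
    have h4 : (Ssign ρ τ.1 : ℂ) ≠ (Ssign ρ τ'.1 : ℂ) := by exact_mod_cast h3
    have z1 : T (Pi.single τ 1 : InvolJ N j → ℂ) τ' = 0 := by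
      by_contra hne; exact h4 (mul_right_cancel₀ hne h)
    have z2 : T (Pi.single τ' 1 : InvolJ N j → ℂ) τ = 0 := by
      by_contra hne; exact h4 (mul_right_cancel₀ hne h').symm
    rw [z1, z2]
end

section
/- The endomorphism algebra End_{Σ_N}(V_j) of the representation π_j is commutative; equivalently, the representation π_j of Σ_N on V_j is multiplicity-free. -/
open Equiv Finset

/-- The space of Σ_N-equivariant endomorphisms of V_j. -/
noncomputable def EndG (N j : ℕ) : Submodule ℂ ((InvolJ N j → ℂ) →ₗ[ℂ] (InvolJ N j → ℂ)) where
  carrier := {T | ∀ σ : Equiv.Perm (Fin N), T ∘ₗ piRep N j σ = piRep N j σ ∘ₗ T}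
  add_mem' := by
    intro a b ha hb σ
    simp only [LinearMap.add_comp, LinearMap.comp_add, ha σ, hb σ]
  zero_mem' := by intro σ; simp
  smul_mem' := by
    intro c a ha σ
    simp only [LinearMap.smul_comp, LinearMap.comp_smul, ha σ]

lemma Ssign_swap_s12 {N : ℕ} (σ κ τ : Equiv.Perm (Fin N)) (hσ : ∀ x, σ (σ x) = x)
    (hκ : ∀ x, κ (κ x) = x) (h : ∀ x, σ (κ x) = τ (σ x)) : Ssign σ κ = Ssign σ τ := by
  unfold Ssign
  congr 1
  have h' : ∀ x, σ (τ x) = κ (σ x) := by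
    intro x
    apply σ.injective
    rw [hσ, h, hσ]
  have hτ : ∀ x, τ (τ x) = x := by
    intro x
    apply σ.injective
    rw [h', h', hκ]
  refine Finset.card_nbij' (fun p => (σ p.2, σ p.1)) (fun p => (σ p.2, σ p.1)) ?_ ?_ ?_ ?_
  · rintro ⟨a, b⟩ hp
    simp only [Finset.coe_filter, Finset.mem_univ, true_and, Set.mem_ofPred_eq] at hp ⊢
    obtain ⟨h1, h2, h3⟩ := hp
    subst h2
    refine ⟨h3, ?_, ?_⟩
    · rw [← h, hκ]
    · rw [hσ, hσ]; exact h1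
  · rintro ⟨a, b⟩ hp
    simp only [Finset.coe_filter, Finset.mem_univ, true_and, Set.mem_ofPred_eq] at hp ⊢
    obtain ⟨h1, h2, h3⟩ := hp
    subst h2
    refine ⟨h3, ?_, ?_⟩
    · rw [← h', hτ]
    · rw [hσ, hσ]; exact h1
  · rintro ⟨a, b⟩ _
    simp [hσ]
  · rintro ⟨a, b⟩ _
    simp [hσ]

lemma Ssign_sq {N : ℕ} (σ κ : Equiv.Perm (Fin N)) : (Ssign σ κ : ℂ) * Ssign σ κ = 1 := by
  unfold Ssign
  push_cast
  rw [← mul_pow]; simp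

lemma Ssign_comm {N : ℕ} (σ κ : Equiv.Perm (Fin N)) (hσ : ∀ x, σ (σ x) = x)
    (hκ : ∀ x, κ (κ x) = x) (h : ∀ x, σ (κ x) = κ (σ x)) :
    Ssign σ κ = (-1) ^ (Finset.univ.filter (fun a => a < κ a ∧ σ a = κ a)).card := by
  have h1 : (Finset.univ.filter (fun p : Fin N × Fin N =>
      p.1 < p.2 ∧ κ p.1 = p.2 ∧ σ p.2 < σ p.1)).card
      = (Finset.univ.filter (fun a => a < κ a ∧ σ (κ a) < σ a)).card := by
    refine Finset.card_nbij' (fun p => p.1) (fun a => (a, κ a)) ?_ ?_ ?_ ?_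
    · rintro ⟨a, b⟩ hp
      simp only [Finset.coe_filter, Finset.mem_univ, true_and, Set.mem_ofPred_eq] at hp ⊢
      obtain ⟨h1, h2, h3⟩ := hp
      subst h2
      exact ⟨h1, h3⟩
    · intro a hp
      simpa using hp
    · rintro ⟨a, b⟩ hp
      simp only [Finset.coe_filter, Finset.mem_univ, true_and, Set.mem_ofPred_eq] at hp ⊢
      rw [hp.2.1]
    · intro a _
      rfl
  unfold Ssign
  rw [h1, ← Finset.card_filter_add_card_filter_not (fun a => σ a = κ a), pow_add,
    Finset.filter_filter, Finset.filter_filter]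
  have h2 : (Finset.univ.filter (fun a => (a < κ a ∧ σ (κ a) < σ a) ∧ σ a = κ a))
      = Finset.univ.filter (fun a => a < κ a ∧ σ a = κ a) := by
    ext a
    simp only [Finset.mem_filter, Finset.mem_univ, true_and]
    constructor
    · rintro ⟨⟨h1, _⟩, h2⟩; exact ⟨h1, h2⟩
    · rintro ⟨h1, h2⟩
      refine ⟨⟨h1, ?_⟩, h2⟩
      rw [h, h2, hκ]; exact h1
  have h3 : (-1 : ℤ) ^ (Finset.univ.filter
      (fun a => (a < κ a ∧ σ (κ a) < σ a) ∧ ¬ σ a = κ a)).card = 1 := by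
    rw [← Finset.prod_const]
    refine Finset.prod_involution (fun a _ => κ (σ a)) ?_ ?_ ?_ ?_
    · intros; norm_num
    · intro a ha _ heq
      simp only [Finset.mem_filter, Finset.mem_univ, true_and] at ha
      apply ha.2
      rw [← hκ (σ a), heq]
    · intro a ha
      simp only [Finset.mem_filter, Finset.mem_univ, true_and] at ha ⊢
      obtain ⟨⟨h1, h2⟩, h3⟩ := ha
      refine ⟨⟨?_, ?_⟩, ?_⟩
      · rw [hκ, ← h]; exact h2
      · rw [hκ, hσ, h, hσ]; exact h1
      · rw [hκ, h, hσ]; exact fun e => h3 e.symm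
    · intro a _
      rw [h, hσ, hκ]
  rw [h2, h3, mul_one]

lemma refl_zpow {N : ℕ} (r κ : Equiv.Perm (Fin N)) (hr : κ * r = r⁻¹ * κ) (n : ℤ) (x : Fin N) :
    κ ((r ^ n) x) = (r ^ (-n)) (κ x) := by
  have h : SemiconjBy κ r r⁻¹ := hr
  have h2 := (h.zpow_right n).eq
  rw [inv_zpow, ← zpow_neg] at h2
  exact congrArg (fun g : Equiv.Perm (Fin N) => g x) h2

lemma zpow_zpow_apply {N : ℕ} (r : Equiv.Perm (Fin N)) (n m : ℤ) (x : Fin N) :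
    (r ^ n) ((r ^ m) x) = (r ^ (n + m)) x := by
  rw [zpow_add]; rfl

lemma zpow_fix_iff {N : ℕ} (r : Equiv.Perm (Fin N)) (x : Fin N) (n : ℤ) :
    (r ^ n) x = x ↔ (orderOf (r.cycleOf x) : ℤ) ∣ n := by
  rw [orderOf_dvd_iff_zpow_eq_one]
  constructor
  · intro h
    ext y
    by_cases hy : r.SameCycle x y
    · obtain ⟨m, rfl⟩ := hy
      have e : (r.cycleOf x ^ n) ((r ^ m) x) = (r ^ m) x := by
        rw [← Equiv.Perm.cycleOf_zpow_apply_self r x m, zpow_zpow_apply, add_comm,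
          Equiv.Perm.cycleOf_zpow_apply_self, ← zpow_zpow_apply, h,
          Equiv.Perm.cycleOf_zpow_apply_self]
      rw [e]; rfl
    · have : r.cycleOf x y = y := Equiv.Perm.cycleOf_apply_of_not_sameCycle hy
      rw [Equiv.Perm.zpow_apply_eq_self_of_apply_eq_self this]
      simp
  · intro h
    rw [← Equiv.Perm.cycleOf_zpow_apply_self, h]; rfl

lemma zpow_eq_iff {N : ℕ} (r : Equiv.Perm (Fin N)) (x : Fin N) (n m : ℤ) :
    (r ^ n) x = (r ^ m) x ↔ (orderOf (r.cycleOf x) : ℤ) ∣ n - m := by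
  rw [← zpow_fix_iff, ← (r ^ (-m)).injective.eq_iff, zpow_zpow_apply, zpow_zpow_apply]
  rw [show -m + n = n - m by ring, show -m + m = 0 by ring]
  simp

lemma halfturn_apply {N : ℕ} (r : Equiv.Perm (Fin N)) (x : Fin N) (k : ℕ) (n : ℤ) :
    (r.cycleOf x ^ k) ((r ^ n) x) = (r ^ (n + k)) x := by
  rw [← Equiv.Perm.cycleOf_zpow_apply_self r x n, ← zpow_natCast, zpow_zpow_apply,
    Equiv.Perm.cycleOf_zpow_apply_self, add_comm]

lemma halfturn_apply_not {N : ℕ} (r : Equiv.Perm (Fin N)) (x y : Fin N) (k : ℕ)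
    (hy : ¬ ∃ n : ℤ, (r ^ n) x = y) :
    (r.cycleOf x ^ k) y = y := by
  have : r.cycleOf x y = y := Equiv.Perm.cycleOf_apply_of_not_sameCycle hy
  exact Equiv.Perm.pow_apply_eq_self_of_apply_eq_self this k

lemma halfturn_invol {N : ℕ} (r : Equiv.Perm (Fin N)) (x : Fin N) (k : ℕ)
    (hk : orderOf (r.cycleOf x) = 2 * k) (y : Fin N) :
    (r.cycleOf x ^ k) ((r.cycleOf x ^ k) y) = y := by
  rw [← Equiv.Perm.mul_apply, ← pow_add, ← two_mul, ← hk, pow_orderOf_eq_one]; rfl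

lemma halfturn_comm {N : ℕ} (r κ : Equiv.Perm (Fin N)) (x : Fin N) (k : ℕ) (c : ℤ)
    (hk : orderOf (r.cycleOf x) = 2 * k) (hκ : ∀ x, κ (κ x) = x)
    (hr : κ * r = r⁻¹ * κ) (hc : κ x = (r ^ c) x) (y : Fin N) :
    (r.cycleOf x ^ k) (κ y) = κ ((r.cycleOf x ^ k) y) := by
  by_cases hy : ∃ n : ℤ, (r ^ n) x = y
  · obtain ⟨n, rfl⟩ := hy
    rw [halfturn_apply, refl_zpow r κ hr, refl_zpow r κ hr, hc, zpow_zpow_apply, zpow_zpow_apply,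
      halfturn_apply, zpow_eq_iff, hk]
    exact ⟨1, by push_cast; ring⟩
  · rw [halfturn_apply_not r x y k hy, halfturn_apply_not]
    rintro ⟨n, hn⟩
    apply hy
    refine ⟨-n + c, ?_⟩
    rw [← zpow_zpow_apply, ← hc, ← refl_zpow r κ hr, hn, hκ]

lemma halfturn_sign {N : ℕ} (r κ : Equiv.Perm (Fin N)) (x : Fin N) (k : ℕ) (c : ℤ)
    (hk : orderOf (r.cycleOf x) = 2 * k) (hκ : ∀ x, κ (κ x) = x)
    (hr : κ * r = r⁻¹ * κ) (hc : κ x = (r ^ c) x) :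
    Ssign (r.cycleOf x ^ k) κ = if Even ((k : ℤ) - c) then -1 else 1 := by
  have hkpos : 0 < k := by
    have := orderOf_pos (r.cycleOf x)
    omega
  rw [Ssign_comm _ _ (halfturn_invol r x k hk) hκ (halfturn_comm r κ x k c hk hκ hr hc)]
  have hmov : ∀ n : ℤ, (r ^ (n + k)) x ≠ (r ^ n) x := by
    intro n h
    rw [zpow_eq_iff, hk] at h
    obtain ⟨q, hq⟩ := h
    have : (k : ℤ) * (2 * q - 1) = 0 := by push_cast at hq; linear_combination -hq
    rcases mul_eq_zero.1 this with h | h <;> omega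
  have hmem : ∀ a, a < κ a ∧ (r.cycleOf x ^ k) a = κ a →
      ∃ n : ℤ, (r ^ n) x = a ∧ (2 * k : ℤ) ∣ 2 * n + k - c := by
    rintro a ⟨h1, h2⟩
    by_cases hy : ∃ n : ℤ, (r ^ n) x = a
    · obtain ⟨n, rfl⟩ := hy
      refine ⟨n, rfl, ?_⟩
      rw [halfturn_apply, refl_zpow r κ hr, hc, zpow_zpow_apply, zpow_eq_iff, hk] at h2
      push_cast at h2
      convert h2 using 1
      ring
    · rw [halfturn_apply_not r x a k hy] at h2
      exact absurd h1 (by rw [← h2]; exact lt_irrefl _)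
  split_ifs with he
  · obtain ⟨d, hd⟩ := he
    have hp : κ ((r ^ (-d)) x) = (r ^ (-d + k)) x := by
      rw [refl_zpow r κ hr, hc, zpow_zpow_apply, zpow_eq_iff]
      exact ⟨0, by linear_combination -hd⟩
    have hp' : κ ((r ^ (-d + k)) x) = (r ^ (-d)) x := by rw [← hp, hκ]
    have hs' : (r.cycleOf x ^ k) ((r ^ (-d + k)) x) = (r ^ (-d)) x := by
      rw [← halfturn_apply, halfturn_invol r x k hk]
    have hall : ∀ a, a < κ a ∧ (r.cycleOf x ^ k) a = κ a →
        a = (r ^ (-d)) x ∨ a = (r ^ (-d + k)) x := by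
      intro a ha
      obtain ⟨n, rfl, q, hq⟩ := hmem a ha
      rw [zpow_eq_iff, zpow_eq_iff, hk]
      have hq2 : n + d = k * q := by
        have : 2 * (n + d) = 2 * (k * q) := by linear_combination hq - hd
        linarith
      rcases Int.even_or_odd' q with ⟨w, rfl | rfl⟩
      · left; exact ⟨w, by push_cast; linear_combination hq2⟩
      · right; exact ⟨w, by push_cast; linear_combination hq2⟩
    have hcard : (Finset.univ.filter (fun a => a < κ a ∧ (r.cycleOf x ^ k) a = κ a)).card = 1 := by
      rw [Finset.card_eq_one]
      rcases lt_or_gt_of_ne (hmov (-d)) with hlt | hlt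
      · refine ⟨(r ^ (-d + k)) x, ?_⟩
        ext a
        simp only [Finset.mem_filter, Finset.mem_univ, true_and, Finset.mem_singleton]
        constructor
        · intro ha
          rcases hall a ha with rfl | rfl
          · exact absurd ha.1 (by rw [hp]; exact not_lt_of_gt hlt)
          · rfl
        · rintro rfl
          rw [hp', hs']; exact ⟨hlt, rfl⟩
      · refine ⟨(r ^ (-d)) x, ?_⟩
        ext a
        simp only [Finset.mem_filter, Finset.mem_univ, true_and, Finset.mem_singleton]
        constructor
        · intro ha
          rcases hall a ha with rfl | rfl
          · rfl
          · exact absurd ha.1 (by rw [hp']; exact not_lt_of_gt hlt)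
        · rintro rfl
          rw [hp, halfturn_apply]; exact ⟨hlt, rfl⟩
    rw [hcard]; norm_num
  · have hcard : (Finset.univ.filter (fun a => a < κ a ∧ (r.cycleOf x ^ k) a = κ a)) = ∅ := by
      rw [Finset.filter_eq_empty_iff]
      intro a _ ha
      obtain ⟨n, -, q, hq⟩ := hmem a ha
      apply he
      exact ⟨k * q - n, by linear_combination hq⟩
    rw [hcard]; norm_num

/-- The subgroup generated by `(κ, τ)` and `(τ, κ)`. -/
def swapGrp {N : ℕ} (κ τ : Equiv.Perm (Fin N)) :
    Subgroup (Equiv.Perm (Fin N) × Equiv.Perm (Fin N)) :=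
  Subgroup.closure {(κ, τ), (τ, κ)}

lemma swapGrp_swap {N : ℕ} (κ τ : Equiv.Perm (Fin N))
    (h : Equiv.Perm (Fin N) × Equiv.Perm (Fin N)) (hh : h ∈ swapGrp κ τ) :
    (h.2, h.1) ∈ swapGrp κ τ := by
  unfold swapGrp at *
  induction hh using Subgroup.closure_induction with
  | mem x hx =>
    apply Subgroup.subset_closure
    rcases hx with rfl | rfl <;> simp
  | one => exact Subgroup.one_mem _
  | mul x y _ _ hx hy => exact Subgroup.mul_mem _ hx hy
  | inv x _ hx => exact Subgroup.inv_mem _ hx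

lemma swapGrp_form {N : ℕ} (κ τ : Equiv.Perm (Fin N)) (hκ : κ * κ = 1) (hτ : τ * τ = 1)
    (h : Equiv.Perm (Fin N) × Equiv.Perm (Fin N)) (hh : h ∈ swapGrp κ τ) :
    ∃ n : ℤ, (h.1 = (κ * τ) ^ n ∧ h.2 = (κ * τ) ^ (-n)) ∨
      (h.1 = (κ * τ) ^ n * κ ∧ h.2 = (κ * τ) ^ (-n) * τ) := by
  have hκ' : κ⁻¹ = κ := inv_eq_of_mul_eq_one_left hκ
  have hτ' : τ⁻¹ = τ := inv_eq_of_mul_eq_one_left hτ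
  have hrinv : (κ * τ)⁻¹ = τ * κ := by rw [mul_inv_rev, hκ', hτ']
  have e1 : ∀ n : ℤ, κ * (κ * τ) ^ n = (κ * τ) ^ (-n) * κ := by
    intro n
    have : SemiconjBy κ (κ * τ) (κ * τ)⁻¹ := by
      show κ * (κ * τ) = (κ * τ)⁻¹ * κ
      rw [hrinv, mul_assoc, hκ, ← mul_assoc, hκ]; simp
    have h2 := (this.zpow_right n).eq
    rwa [inv_zpow, ← zpow_neg] at h2
  have e2 : ∀ n : ℤ, τ * (κ * τ) ^ n = (κ * τ) ^ (-n) * τ := by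
    intro n
    have : SemiconjBy τ (κ * τ) (κ * τ)⁻¹ := by
      show τ * (κ * τ) = (κ * τ)⁻¹ * τ
      rw [hrinv, mul_assoc]
    have h2 := (this.zpow_right n).eq
    rwa [inv_zpow, ← zpow_neg] at h2
  have e3 : τ = (κ * τ) ^ (-1 : ℤ) * κ := by
    rw [zpow_neg_one, hrinv, mul_assoc, hκ, mul_one]
  have e4 : κ = (κ * τ) ^ (1 : ℤ) * τ := by
    rw [zpow_one, mul_assoc, hτ, mul_one]
  unfold swapGrp at hh
  have step1 : ∀ y : Equiv.Perm (Fin N) × Equiv.Perm (Fin N),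
      (∃ n : ℤ, (y.1 = (κ * τ) ^ n ∧ y.2 = (κ * τ) ^ (-n)) ∨
      (y.1 = (κ * τ) ^ n * κ ∧ y.2 = (κ * τ) ^ (-n) * τ)) →
      ∃ n : ℤ, (κ * y.1 = (κ * τ) ^ n ∧ τ * y.2 = (κ * τ) ^ (-n)) ∨
      (κ * y.1 = (κ * τ) ^ n * κ ∧ τ * y.2 = (κ * τ) ^ (-n) * τ) := by
    rintro y ⟨n, ⟨h1, h2⟩ | ⟨h1, h2⟩⟩
    · refine ⟨-n, Or.inr ⟨?_, ?_⟩⟩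
      · rw [h1, e1]
      · rw [h2, e2]
    · refine ⟨-n, Or.inl ⟨?_, ?_⟩⟩
      · rw [h1, ← mul_assoc, e1, mul_assoc, hκ, mul_one]
      · rw [h2, ← mul_assoc, e2, mul_assoc, hτ, mul_one]
  have step2 : ∀ y : Equiv.Perm (Fin N) × Equiv.Perm (Fin N),
      (∃ n : ℤ, (y.1 = (κ * τ) ^ n ∧ y.2 = (κ * τ) ^ (-n)) ∨
      (y.1 = (κ * τ) ^ n * κ ∧ y.2 = (κ * τ) ^ (-n) * τ)) →
      ∃ n : ℤ, (τ * y.1 = (κ * τ) ^ n ∧ κ * y.2 = (κ * τ) ^ (-n)) ∨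
      (τ * y.1 = (κ * τ) ^ n * κ ∧ κ * y.2 = (κ * τ) ^ (-n) * τ) := by
    rintro y ⟨n, ⟨h1, h2⟩ | ⟨h1, h2⟩⟩
    · refine ⟨-n - 1, Or.inr ⟨?_, ?_⟩⟩
      · rw [h1, e2, sub_eq_add_neg, zpow_add, mul_assoc, ← e3]
      · rw [h2, e1, show -(-n - 1) = - -n + 1 by ring, zpow_add, mul_assoc _ _ τ, ← e4]
    · refine ⟨-n - 1, Or.inl ⟨?_, ?_⟩⟩
      · rw [h1, ← mul_assoc, e2, mul_assoc, sub_eq_add_neg, zpow_add, zpow_neg_one, hrinv]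
      · rw [h2, ← mul_assoc, e1, mul_assoc, show -(-n - 1) = - -n + 1 by ring, zpow_add, zpow_one]
  induction hh using Subgroup.closure_induction_left with
  | one => exact ⟨0, Or.inl (by simp)⟩
  | mul_left x hx y hy ih =>
    rcases hx with rfl | rfl
    · exact step1 y ih
    · exact step2 y ih
  | inv_mul_cancel x hx y hy ih =>
    rcases hx with rfl | rfl
    · simpa [hκ', hτ'] using step1 y ih
    · simpa [hκ', hτ'] using step2 y ih

/-- Gluing: if every component has a good base point there is a swapping involution. -/
lemma exists_swapping {N : ℕ} (κ τ : Equiv.Perm (Fin N)) 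
    (good : ∀ x, ∃ g ∈ swapGrp κ τ, ∀ h ∈ swapGrp κ τ,
      h.1 (g.1 x) = g.1 x → h.2 (g.1 x) = g.1 x) :
    ∃ σ : Equiv.Perm (Fin N), (∀ x, σ (σ x) = x) ∧ (∀ x, σ (κ x) = τ (σ x)) := by
  classical
  let s : Setoid (Fin N) :=
    { r := fun x y => ∃ g ∈ swapGrp κ τ, g.1 x = y
      iseqv := 
        { refl := fun x => ⟨1, Subgroup.one_mem _, rfl⟩
          symm := by
            rintro x y ⟨g, hg, rfl⟩
            exact ⟨g⁻¹, Subgroup.inv_mem _ hg, by simp⟩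
          trans := by
            rintro x y z ⟨g, hg, rfl⟩ ⟨h, hh, rfl⟩
            exact ⟨h * g, Subgroup.mul_mem _ hh hg, by simp⟩ } }
  have hb : ∃ b : Fin N → Fin N, (∀ x, ∀ g ∈ swapGrp κ τ, b (g.1 x) = b x) ∧
      (∀ x, ∃ g ∈ swapGrp κ τ, g.1 (b x) = x) ∧
      (∀ x, ∀ h ∈ swapGrp κ τ, h.1 (b x) = b x → h.2 (b x) = b x) := by
    choose w hw hw2 using good
    let o : Fin N → Fin N := fun x => (Quotient.mk s x).out
    have ho : ∀ x, ∃ g ∈ swapGrp κ τ, g.1 (o x) = x := fun x => Quotient.exact (Quotient.out_eq (Quotient.mk s x))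
    refine ⟨fun x => (w (o x)).1 (o x), ?_, ?_, ?_⟩
    · intro x g hg
      have : o (g.1 x) = o x := by
        have : Quotient.mk s (g.1 x) = Quotient.mk s x := 
          (Quotient.sound (s := s) (show s.r x (g.1 x) from ⟨g, hg, rfl⟩)).symm
        simp only [o, this]
      simp only [this]
    · intro x
      obtain ⟨g, hg, hx⟩ := ho x
      refine ⟨g * (w (o x))⁻¹, Subgroup.mul_mem _ hg (Subgroup.inv_mem _ (hw _)), ?_⟩
      simpa using hx
    · intro x
      exact hw2 (o x)
  obtain ⟨b, hb1, hb2, hb3⟩ := hb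
  choose g hg hgx using hb2
  let f : Fin N → Fin N := fun x => (g x).2 (b x)
  have key : ∀ x, ∀ h ∈ swapGrp κ τ, h.1 (b x) = x → f x = h.2 (b x) := by
    intro x h hh hx
    have := hb3 x (h⁻¹ * g x) (Subgroup.mul_mem _ (Subgroup.inv_mem _ hh) (hg x)) (by
      simp only [Prod.fst_mul, Prod.fst_inv, Equiv.Perm.mul_apply, hgx]
      rw [Equiv.Perm.inv_eq_iff_eq]; exact hx.symm)
    simp only [Prod.snd_mul, Prod.snd_inv, Equiv.Perm.mul_apply] at this
    rw [Equiv.Perm.inv_eq_iff_eq] at this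
    exact this
  have hbf : ∀ x, b (f x) = b x := by
    intro x
    have h1 := hb1 (b x) _ (swapGrp_swap κ τ _ (hg x))
    have h2 := hb1 (b x) _ (hg x)
    rw [hgx] at h2
    exact h1.trans h2.symm
  have hff : ∀ x, f (f x) = x := by
    intro x
    rw [key (f x) _ (swapGrp_swap κ τ _ (hg x)) (by rw [hbf])]
    rw [hbf]; exact hgx x
  refine ⟨⟨f, f, hff, hff⟩, hff, ?_⟩
  intro x
  have hmem : (κ, τ) ∈ swapGrp κ τ := Subgroup.subset_closure (by simp)
  have hbk : b (κ x) = b x := hb1 x _ hmem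
  have := key (κ x) ((κ, τ) * g x) (Subgroup.mul_mem _ hmem (hg x)) (by
    simp [hbk, hgx])
  show f (κ x) = τ (f x)
  rw [this, hbk]; rfl

lemma dichotomy {N : ℕ} (κ τ : Equiv.Perm (Fin N)) (hκ : κ * κ = 1) (hτ : τ * τ = 1) :
    (∃ σ : Equiv.Perm (Fin N), (∀ x, σ (σ x) = x) ∧ (∀ x, σ (κ x) = τ (σ x))) ∨
    (∃ σ : Equiv.Perm (Fin N), (∀ x, σ (κ x) = κ (σ x)) ∧ (∀ x, σ (τ x) = τ (σ x)) ∧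
      Ssign σ κ * Ssign σ τ = -1) := by
  by_cases good : ∀ x, ∃ g ∈ swapGrp κ τ, ∀ h ∈ swapGrp κ τ,
      h.1 (g.1 x) = g.1 x → h.2 (g.1 x) = g.1 x
  · exact Or.inl (exists_swapping κ τ good)
  right
  push Not at good
  obtain ⟨x, hx⟩ := good
  have hκx : ∀ y, κ (κ y) = y := fun y => congrArg (fun g : Equiv.Perm (Fin N) => g y) hκ
  have hτx : ∀ y, τ (τ y) = y := fun y => congrArg (fun g : Equiv.Perm (Fin N) => g y) hτ
  have hκ' : κ⁻¹ = κ := inv_eq_of_mul_eq_one_left hκ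
  have hτ' : τ⁻¹ = τ := inv_eq_of_mul_eq_one_left hτ
  have hrκ : κ * (κ * τ) = (κ * τ)⁻¹ * κ := by
    rw [mul_inv_rev, hκ', hτ', mul_assoc, hκ, ← mul_assoc, hκ]; simp
  have hrτ : τ * (κ * τ) = (κ * τ)⁻¹ * τ := by
    rw [mul_inv_rev, hκ', hτ', mul_assoc]
  have hτr : ∀ y, τ y = ((κ * τ) ^ (-1 : ℤ)) (κ y) := by
    intro y
    rw [zpow_neg_one, mul_inv_rev, hκ', hτ', Equiv.Perm.mul_apply, hκx]
  have hmem : (κ * τ, τ * κ) ∈ swapGrp κ τ := 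
    Subgroup.mul_mem _ (x := (κ, τ)) (y := (τ, κ)) (Subgroup.subset_closure (by simp))
      (Subgroup.subset_closure (by simp))
  have hform := swapGrp_form κ τ hκ hτ
  generalize hr : κ * τ = r at *
  -- bad point analysis
  have hbad : ∀ i : ℤ, ∃ n : ℤ, (r ^ n) (κ ((r ^ i) x)) = (r ^ i) x ∧
      (r ^ (-n)) (τ ((r ^ i) x)) ≠ (r ^ i) x := by
    intro i
    obtain ⟨h, hh, h1, h2⟩ := hx ((r, τ * κ) ^ i) (Subgroup.zpow_mem _ hmem i)
    have hfst : ((r, τ * κ) ^ i).1 = r ^ i := by simp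
    rw [hfst] at h1 h2
    obtain ⟨n, ⟨e1, e2⟩ | ⟨e1, e2⟩⟩ := hform h hh
    · exfalso
      apply h2
      rw [e1] at h1
      rw [e2, zpow_neg, Equiv.Perm.inv_eq_iff_eq, h1]
    · refine ⟨n, ?_, ?_⟩
      · rw [e1] at h1; exact h1
      · rw [e2] at h2; exact h2
  obtain ⟨n, hn, -⟩ := hbad 0
  simp only [zpow_zero, Equiv.Perm.coe_one, id_eq] at hn
  have hc : κ x = (r ^ (-n)) x := by
    rw [zpow_neg, Equiv.Perm.eq_inv_iff_eq]; exact hn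
  have hc' : τ x = (r ^ (-n - 1)) x := by
    rw [hτr, hc, zpow_zpow_apply]; congr 2; ring
  rcases Nat.even_or_odd' (orderOf (r.cycleOf x)) with ⟨k, hk | hk⟩
  · refine ⟨r.cycleOf x ^ k, halfturn_comm r κ x k _ hk hκx hrκ hc,
      halfturn_comm r τ x k _ hk hτx hrτ hc', ?_⟩
    rw [halfturn_sign r κ x k _ hk hκx hrκ hc, halfturn_sign r τ x k _ hk hτx hrτ hc']
    have : Even ((k : ℤ) - (-n - 1)) ↔ ¬ Even ((k : ℤ) - -n) := by
      rw [show (k : ℤ) - (-n - 1) = (k - -n) + 1 by ring, Int.even_add_one]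
    by_cases he : Even ((k : ℤ) - -n)
    · rw [if_pos he, if_neg (by rw [this]; exact not_not.2 he)]; norm_num
    · rw [if_neg he, if_pos (this.2 he)]; norm_num
  · exfalso
    -- inverse of 4 modulo 2k+1 is (k+1)^2
    obtain ⟨m, hm1, hm2⟩ := hbad ((-2 * n - 1) * (k + 1) ^ 2)
    apply hm2
    generalize hi : (-2 * n - 1) * ((k : ℤ) + 1) ^ 2 = i at *
    rw [refl_zpow r κ hrκ, hc, zpow_zpow_apply, zpow_zpow_apply, zpow_eq_iff, hk] at hm1
    rw [refl_zpow r τ hrτ, hc', zpow_zpow_apply, zpow_zpow_apply, zpow_eq_iff, hk]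
    obtain ⟨q, hq⟩ := hm1
    push_cast at hq ⊢
    -- goal : 2k+1 ∣ -m + (-i + (-n-1)) - i
    refine ⟨-q - (-2 * n - 1) * (2 * k + 3), ?_⟩
    linear_combination -hq + 4 * hi

lemma kernel_equivariant {N j : ℕ} (T : (InvolJ N j → ℂ) →ₗ[ℂ] (InvolJ N j → ℂ))
    (hT : T ∈ EndG N j) (σ : Equiv.Perm (Fin N)) (κ τ : InvolJ N j) :
    (Ssign σ τ.1 : ℂ) * T (Pi.single (involConj σ τ) 1) (involConj σ κ) =
      (Ssign σ κ.1 : ℂ) * T (Pi.single τ 1) κ := by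
  have h := congrArg (fun L => L (Pi.single τ 1) (involConj σ κ)) (hT σ)
  simp only [LinearMap.comp_apply, piRep_single, map_smul, Pi.smul_apply, smul_eq_mul] at h
  rw [h]
  have h3 : involConj σ⁻¹ (involConj σ κ) = κ := by
    apply Subtype.ext; simp [involConj, mul_assoc]
  simp only [piRep, LinearMap.coe_mk, AddHom.coe_mk]
  rw [h3]

lemma involConj_eq {N j : ℕ} (σ : Equiv.Perm (Fin N)) (κ τ : InvolJ N j)
    (h : ∀ x, σ (κ.1 x) = τ.1 (σ x)) : involConj σ κ = τ := by
  apply Subtype.ext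
  show σ * κ.1 * σ⁻¹ = τ.1
  rw [mul_inv_eq_iff_eq_mul]
  exact Equiv.ext h

lemma kernel_symm {N j : ℕ} (T : (InvolJ N j → ℂ) →ₗ[ℂ] (InvolJ N j → ℂ))
    (hT : T ∈ EndG N j) (κ τ : InvolJ N j) :
    T (Pi.single κ 1) τ = T (Pi.single τ 1) κ := by
  rcases dichotomy κ.1 τ.1 κ.2.1 τ.2.1 with ⟨σ, hσ, h⟩ | ⟨σ, h1, h2, h3⟩
  · have hκ : ∀ y, κ.1 (κ.1 y) = y :=
      fun y => congrArg (fun g : Equiv.Perm (Fin N) => g y) κ.2.1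
    have hs := Ssign_swap_s12 σ κ.1 τ.1 hσ hκ h
    have h' : ∀ x, σ (τ.1 x) = κ.1 (σ x) := by
      intro x
      apply σ.injective
      rw [hσ, h, hσ]
    have he := kernel_equivariant T hT σ κ τ
    rw [involConj_eq σ κ τ h, involConj_eq σ τ κ h', hs] at he
    have hne : (Ssign σ τ.1 : ℂ) ≠ 0 := by
      intro h0
      have := Ssign_sq σ τ.1
      rw [h0] at this
      simp at this
    exact mul_left_cancel₀ hne he
  · have hz : ∀ a b : InvolJ N j, involConj σ a = a → involConj σ b = b →
        (Ssign σ a.1 : ℂ) * Ssign σ b.1 = -1 → T (Pi.single a 1) b = 0 := by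
      intro a b ha hb hab
      have he := kernel_equivariant T hT σ b a
      rw [ha, hb] at he
      have hsq := Ssign_sq σ a.1
      linear_combination (1 / 2 : ℂ) * (Ssign σ a.1 : ℂ) * he
        - (1 / 2 : ℂ) * T (Pi.single a 1) b * hsq + (1 / 2 : ℂ) * T (Pi.single a 1) b * hab
    have hκ := involConj_eq σ κ κ h1
    have hτ := involConj_eq σ τ τ h2
    have h4 : (Ssign σ κ.1 : ℂ) * Ssign σ τ.1 = -1 := by exact_mod_cast h3
    rw [hz κ τ hκ hτ h4, hz τ κ hτ hκ (by rw [mul_comm]; exact h4)]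

lemma toMatrix_symm {N j : ℕ} (T : (InvolJ N j → ℂ) →ₗ[ℂ] (InvolJ N j → ℂ))
    (hT : T ∈ EndG N j) : (LinearMap.toMatrix' T).transpose = LinearMap.toMatrix' T := by
  ext κ τ
  rw [Matrix.transpose_apply, LinearMap.toMatrix'_apply, LinearMap.toMatrix'_apply]
  exact kernel_symm T hT κ τ

/-- The endomorphism algebra End_{Σ_N}(V_j) is commutative (equivalently, π_j
is multiplicity-free). -/
theorem EndG_commutative (N j : ℕ) :
    ∀ T T' : (InvolJ N j → ℂ) →ₗ[ℂ] (InvolJ N j → ℂ),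
      T ∈ EndG N j → T' ∈ EndG N j → T ∘ₗ T' = T' ∘ₗ T := by
  intro T T' hT hT'
  have hTT : T ∘ₗ T' ∈ EndG N j := by
    intro σ
    rw [LinearMap.comp_assoc, hT' σ, ← LinearMap.comp_assoc, hT σ, LinearMap.comp_assoc]
  apply LinearMap.toMatrix'.injective
  rw [← toMatrix_symm _ hTT, LinearMap.toMatrix'_comp, Matrix.transpose_mul,
    toMatrix_symm _ hT, toMatrix_symm _ hT', LinearMap.toMatrix'_comp]
end

section
/- Let A = ⊕_{j=0}^{⌊N/2⌋} V_j with the Σ_N-representation ⊕_j π_j. Then dim_ℂ End_{Σ_N}(A) equals the number of partitions of N. -/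
open Equiv Finset

/-- The set of all involutions of Σ_N (including the identity). -/
def Invol (N : ℕ) : Type := {τ : Equiv.Perm (Fin N) // τ * τ = 1}

instance (N : ℕ) : Fintype (Invol N) := by unfold Invol; infer_instance
instance (N : ℕ) : DecidableEq (Invol N) := by unfold Invol; infer_instance

def involConjA {N : ℕ} (σ : Equiv.Perm (Fin N)) (τ : Invol N) : Invol N :=
  ⟨σ * τ.1 * σ⁻¹,
   by rw [show σ * τ.1 * σ⁻¹ * (σ * τ.1 * σ⁻¹) = σ * (τ.1 * τ.1) * σ⁻¹ by group, τ.2]; simp⟩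

/-- The representation A = ⊕_j (V_j, π_j) of Σ_N on the span of all
involutions, given on basis vectors by σ·τ = S(σ,τ)·στσ⁻¹. -/
noncomputable def piRepA (N : ℕ) (σ : Equiv.Perm (Fin N)) :
    (Invol N → ℂ) →ₗ[ℂ] (Invol N → ℂ) where
  toFun f := fun κ => (Ssign σ (involConjA σ⁻¹ κ).1 : ℂ) * f (involConjA σ⁻¹ κ)
  map_add' := by intro f g; funext κ; simp [mul_add]
  map_smul' := by intro c f; funext κ; simp; ring

/-- The space of Σ_N-equivariant endomorphisms of A. -/
noncomputable def EndGA (N : ℕ) : Submodule ℂ ((Invol N → ℂ) →ₗ[ℂ] (Invol N → ℂ)) where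
  carrier := {T | ∀ σ : Equiv.Perm (Fin N), T ∘ₗ piRepA N σ = piRepA N σ ∘ₗ T}
  add_mem' := by
    intro a b ha hb σ
    simp only [LinearMap.add_comp, LinearMap.comp_add, ha σ, hb σ]
  zero_mem' := by intro σ; simp
  smul_mem' := by
    intro c a ha σ
    simp only [LinearMap.smul_comp, LinearMap.comp_smul, ha σ]


/-- A set `P` of representatives of the 2-cycles of the involution `τ`. -/
def IsTransv {X : Type*} (τ : Equiv.Perm X) (P : Finset X) : Prop :=
  (∀ x ∈ P, τ x ≠ x) ∧ ∀ x, τ x ≠ x → (x ∈ P ↔ τ x ∉ P)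

theorem edge_prod {X M : Type*} [DecidableEq X] [CommMonoid M] (τ : Equiv.Perm X)
    (hτ : ∀ x, τ (τ x) = x) (g : X → M) (hg : ∀ x, g (τ x) = g x) (P Q : Finset X)
    (hP : IsTransv τ P) (hQ : IsTransv τ Q) : ∏ x ∈ P, g x = ∏ x ∈ Q, g x := by
  rw [← Finset.prod_inter_mul_prod_sdiff P Q, ← Finset.prod_inter_mul_prod_sdiff Q P,
    Finset.inter_comm Q P]
  congr 1
  refine Finset.prod_nbij' (fun x => τ x) (fun x => τ x) ?_ ?_ ?_ ?_ ?_
  · intro x hx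
    rw [Finset.mem_sdiff] at hx ⊢
    have h1 := hP.1 x hx.1
    have := hP.2 x h1
    have := hQ.2 x h1
    tauto
  · intro x hx
    rw [Finset.mem_sdiff] at hx ⊢
    have h1 := hQ.1 x hx.1
    have := hP.2 x h1
    have := hQ.2 x h1
    tauto
  · intro x _; exact hτ x
  · intro x _; exact hτ x
  · intro x _; exact (hg x).symm

/-- Orientation of a pair. -/
def ori {N : ℕ} (a b : Fin N) : ℤ := if a < b then 1 else -1

theorem ori_sq {N : ℕ} (a b : Fin N) : ori a b * ori a b = 1 := by
  unfold ori; split <;> rfl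

theorem ori_swap {N : ℕ} {a b : Fin N} (h : a ≠ b) : ori b a = - ori a b := by
  unfold ori
  rcases lt_or_gt_of_ne h with h | h
  · simp [h, not_lt.2 h.le]
  · simp [h, not_lt.2 h.le]

def stdP {N : ℕ} (τ : Equiv.Perm (Fin N)) : Finset (Fin N) := Finset.univ.filter (fun x => x < τ x)

theorem stdP_transv {N : ℕ} (τ : Equiv.Perm (Fin N)) (hτ : ∀ x, τ (τ x) = x) :
    IsTransv τ (stdP τ) := by
  constructor
  · intro x hx
    simp [stdP] at hx
    exact hx.ne'
  · intro x hx
    simp only [stdP, Finset.mem_filter, Finset.mem_univ, true_and, hτ, not_lt]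
    exact ⟨fun h => h.le, fun h => lt_of_le_of_ne h hx.symm⟩

theorem Ssign_eq {N : ℕ} (σ τ : Equiv.Perm (Fin N)) :
    Ssign σ τ = ∏ x ∈ stdP τ, ori x (τ x) * ori (σ x) (σ (τ x)) := by
  have h1 : ∏ x ∈ stdP τ, ori x (τ x) * ori (σ x) (σ (τ x)) =
      ∏ x ∈ stdP τ, if σ (τ x) < σ x then (-1 : ℤ) else 1 := by
    refine Finset.prod_congr rfl fun x hx => ?_
    simp only [stdP, Finset.mem_filter, Finset.mem_univ, true_and] at hx
    have hne : σ x ≠ σ (τ x) := fun h => hx.ne (σ.injective h)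
    unfold ori
    rcases lt_or_gt_of_ne hne with h | h
    · simp [hx, h, not_lt.2 h.le]
    · simp [hx, h, not_lt.2 h.le]
  rw [h1, Finset.prod_ite]
  simp only [Finset.prod_const, one_pow, mul_one]
  unfold Ssign
  congr 1
  refine Finset.card_nbij' (fun p => p.1) (fun x => (x, τ x)) ?_ ?_ ?_ ?_
  · rintro ⟨a, b⟩ h
    simp [stdP] at h ⊢
    obtain ⟨h1, h2, h3⟩ := h
    subst h2
    exact ⟨h1, h3⟩
  · intro x h
    simp [stdP] at h ⊢
    exact h
  · rintro ⟨a, b⟩ h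
    simp at h ⊢
    exact h.2.1
  · intro x _; rfl

theorem Ssign_transv {N : ℕ} (σ τ : Equiv.Perm (Fin N)) (hτ : ∀ x, τ (τ x) = x)
    (P : Finset (Fin N)) (hP : IsTransv τ P) :
    Ssign σ τ = ∏ x ∈ P, ori x (τ x) * ori (σ x) (σ (τ x)) := by
  rw [Ssign_eq]
  refine edge_prod τ hτ _ ?_ _ _ (stdP_transv τ hτ) hP
  intro x
  by_cases h : τ x = x
  · rw [h, h]
  · rw [hτ, ori_swap (Ne.symm h), ori_swap (a := σ x) (b := σ (τ x))]
    · ring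
    · intro h'; exact h (σ.injective h').symm

theorem Ssign_mul {N : ℕ} (σ σ' τ : Equiv.Perm (Fin N)) (hτ : ∀ x, τ (τ x) = x) :
    Ssign (σ * σ') τ = Ssign σ (σ' * τ * σ'⁻¹) * Ssign σ' τ := by
  have hP := stdP_transv τ hτ
  have hτ' : ∀ x, (σ' * τ * σ'⁻¹) ((σ' * τ * σ'⁻¹) x) = x := by
    intro x; simp [hτ]
  have hQ : IsTransv (σ' * τ * σ'⁻¹) ((stdP τ).map σ'.toEmbedding) := by
    constructor
    · intro x hx
      simp only [Finset.mem_map_equiv] at hx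
      have := hP.1 _ hx
      intro h
      apply this
      apply σ'.injective
      simpa using h
    · intro x hx
      simp only [Finset.mem_map_equiv]
      have h2 : τ (σ'.symm x) ≠ σ'.symm x := by
        intro h; apply hx; 
        have := congrArg σ' h
        simpa using this
      have := hP.2 _ h2
      simpa using this
  rw [Ssign_transv σ _ hτ' _ hQ, Ssign_eq, Ssign_eq, Finset.prod_map, ← Finset.prod_mul_distrib]
  refine Finset.prod_congr rfl fun x _ => ?_
  have hi : σ'⁻¹ (σ' x) = x := by simp
  simp only [Equiv.coe_toEmbedding, Equiv.Perm.mul_apply, hi]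
  have := ori_sq (σ' x) (σ' (τ x))
  linear_combination (-ori x (τ x) * ori (σ (σ' x)) (σ (σ' (τ x)))) * this

theorem Invol.sq {N : ℕ} (τ : Invol N) (x : Fin N) : τ.1 (τ.1 x) = x := by
  have := τ.2
  exact congrArg (fun p : Equiv.Perm (Fin N) => p x) this

theorem involConjA_mul {N : ℕ} (σ σ' : Equiv.Perm (Fin N)) (κ : Invol N) :
    involConjA (σ * σ') κ = involConjA σ (involConjA σ' κ) := by
  apply Subtype.ext
  simp [involConjA, mul_assoc]

theorem involConjA_one {N : ℕ} (κ : Invol N) : involConjA 1 κ = κ := by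
  apply Subtype.ext
  simp [involConjA]

theorem Ssign_one_s15 {N : ℕ} (τ : Equiv.Perm (Fin N)) : Ssign 1 τ = 1 := by
  rw [Ssign_eq]
  exact Finset.prod_eq_one fun x _ => ori_sq _ _

theorem piRepA_apply {N : ℕ} (σ : Equiv.Perm (Fin N)) (f : Invol N → ℂ) (κ : Invol N) :
    piRepA N σ f κ = (Ssign σ (involConjA σ⁻¹ κ).1 : ℂ) * f (involConjA σ⁻¹ κ) := rfl

noncomputable def repA (N : ℕ) : Representation ℂ (Equiv.Perm (Fin N)) (Invol N → ℂ) where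
  toFun σ := piRepA N σ
  map_one' := by
    refine LinearMap.ext fun f => funext fun κ => ?_
    rw [piRepA_apply, Ssign_one_s15, inv_one, involConjA_one]
    simp
  map_mul' σ σ' := by
    refine LinearMap.ext fun f => funext fun κ => ?_
    rw [Module.End.mul_apply, piRepA_apply, piRepA_apply, piRepA_apply, mul_inv_rev,
      involConjA_mul]
    have h1 := Ssign_mul σ σ' (involConjA σ'⁻¹ (involConjA σ⁻¹ κ)).1 (Invol.sq _)
    have h2 : involConjA σ' (involConjA σ'⁻¹ (involConjA σ⁻¹ κ)) = involConjA σ⁻¹ κ := by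
      rw [← involConjA_mul, mul_inv_cancel, involConjA_one]
    have h3 : σ' * (involConjA σ'⁻¹ (involConjA σ⁻¹ κ)).1 * σ'⁻¹ = (involConjA σ⁻¹ κ).1 :=
      congrArg Subtype.val h2
    rw [h3] at h1
    rw [h1, Int.cast_mul, mul_assoc]

open Classical in
/-- The involutions commuting with `σ`. -/
noncomputable def commInv {N : ℕ} (σ : Equiv.Perm (Fin N)) : Finset (Equiv.Perm (Fin N)) :=
  Finset.univ.filter fun τ => τ * τ = 1 ∧ Commute σ τ

theorem char_repA {N : ℕ} (σ : Equiv.Perm (Fin N)) :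
    (repA N).character σ = ((∑ τ ∈ commInv σ, Ssign σ τ : ℤ) : ℂ) := by
  classical
  unfold Representation.character
  rw [LinearMap.trace_eq_matrix_trace ℂ (Pi.basisFun ℂ (Invol N)), Matrix.trace]
  have h1 : ∀ τ : Invol N, (LinearMap.toMatrix (Pi.basisFun ℂ (Invol N)) (Pi.basisFun ℂ (Invol N))
      (repA N σ)).diag τ = if Commute σ τ.1 then (Ssign σ τ.1 : ℂ) else 0 := by
    intro τ
    rw [Matrix.diag_apply, LinearMap.toMatrix_apply]
    simp only [Pi.basisFun_apply, Pi.basisFun_repr]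
    have hc : Commute σ τ.1 ↔ involConjA σ⁻¹ τ = τ := by
      refine Iff.trans ?_ (Subtype.ext_iff (a1 := involConjA σ⁻¹ τ) (a2 := τ)).symm
      change _ ↔ σ⁻¹ * τ.1 * σ⁻¹⁻¹ = τ.1
      rw [commute_iff_eq, mul_assoc, inv_mul_eq_iff_eq_mul, eq_comm, inv_inv]
    change (Ssign σ (involConjA σ⁻¹ τ).1 : ℂ) * (Pi.single τ 1 : Invol N → ℂ) (involConjA σ⁻¹ τ) = _
    by_cases h : Commute σ τ.1
    · rw [if_pos h, hc.1 h]; simp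
    · rw [if_neg h, Pi.single_eq_of_ne (fun h' => h (hc.2 h'))]; simp
  rw [Finset.sum_congr rfl fun τ _ => h1 τ, commInv, ← Finset.filter_filter, Finset.sum_filter,
    Int.cast_sum]
  refine Eq.trans (Finset.sum_subtype (Finset.univ.filter
    fun τ : Equiv.Perm (Fin N) => τ * τ = 1)
    (p := fun τ => τ * τ = 1) (by simp)
    (fun τ : Equiv.Perm (Fin N) => if Commute σ τ then (Ssign σ τ : ℂ) else 0)).symm ?_
  refine Finset.sum_congr rfl fun τ _ => ?_
  split_ifs <;> simp

section cyc
variable {N : ℕ}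

theorem pow_fix_iff (σ : Equiv.Perm (Fin N)) (x : Fin N) (n : ℕ) :
    (σ ^ n) x = x ↔ Function.minimalPeriod σ x ∣ n := by
  rw [← Function.isPeriodicPt_iff_minimalPeriod_dvd, Function.IsPeriodicPt, Function.IsFixedPt,
    Equiv.Perm.iterate_eq_pow]

theorem pow_eq_iff (σ : Equiv.Perm (Fin N)) (x : Fin N) (m n : ℕ) :
    (σ ^ m) x = (σ ^ n) x ↔ m ≡ n [MOD Function.minimalPeriod σ x] := by
  wlog h : m ≤ n generalizing m n
  · rw [eq_comm, this n m (by omega)]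
    exact ⟨fun h => h.symm, fun h => h.symm⟩
  · rw [Nat.modEq_iff_dvd' h, ← pow_fix_iff]
    obtain ⟨d, rfl⟩ := Nat.exists_eq_add_of_le h
    rw [pow_add, Equiv.Perm.mul_apply, Nat.add_sub_cancel_left]
    constructor
    · intro h; exact ((σ ^ m).injective h).symm
    · intro h; rw [h]

theorem period_pos (σ : Equiv.Perm (Fin N)) (x : Fin N) : 0 < Function.minimalPeriod σ x := by
  refine Nat.pos_of_ne_zero fun h => ?_
  have := (pow_fix_iff σ x (orderOf σ)).1 (by rw [pow_orderOf_eq_one]; rfl)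
  rw [h, zero_dvd_iff] at this
  exact (orderOf_pos σ).ne' this

theorem sameCycle_nat {σ : Equiv.Perm (Fin N)} {x y : Fin N} (h : σ.SameCycle x y) :
    ∃ n : ℕ, y = (σ ^ n) x := by
  obtain ⟨i, _, hi⟩ := h.exists_pow_eq'
  exact ⟨i, hi.symm⟩

theorem sameCycle_pow' (σ : Equiv.Perm (Fin N)) (x : Fin N) (n : ℕ) :
    σ.SameCycle x ((σ ^ n) x) := ⟨n, by simp⟩

theorem comm_pow {σ τ : Equiv.Perm (Fin N)} (h : ∀ x, τ (σ x) = σ (τ x)) (n : ℕ) (x : Fin N) :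
    τ ((σ ^ n) x) = (σ ^ n) (τ x) := by
  have h1 : Commute τ σ := Equiv.ext h
  exact congrArg (fun p : Equiv.Perm (Fin N) => p x) (h1.pow_right n)

theorem period_comm {σ τ : Equiv.Perm (Fin N)} (h : ∀ x, τ (σ x) = σ (τ x)) (x : Fin N) :
    Function.minimalPeriod σ (τ x) = Function.minimalPeriod σ x := by
  apply Nat.dvd_antisymm
  · rw [← pow_fix_iff, ← comm_pow h, (pow_fix_iff σ x _).2 dvd_rfl]
  · rw [← pow_fix_iff]
    apply τ.injective
    rw [comm_pow h, (pow_fix_iff σ (τ x) _).2 dvd_rfl]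

theorem sameCycle_comm {σ τ : Equiv.Perm (Fin N)} (h : ∀ x, τ (σ x) = σ (τ x)) {x y : Fin N}
    (hxy : σ.SameCycle x y) : σ.SameCycle (τ x) (τ y) := by
  obtain ⟨n, rfl⟩ := sameCycle_nat hxy
  rw [comm_pow h]
  exact sameCycle_pow' _ _ _

theorem period_sameCycle {σ : Equiv.Perm (Fin N)} {x y : Fin N} (h : σ.SameCycle x y) :
    Function.minimalPeriod σ y = Function.minimalPeriod σ x := by
  obtain ⟨n, rfl⟩ := sameCycle_nat h
  exact period_comm (τ := σ ^ n) (fun x => by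
    rw [← Equiv.Perm.mul_apply, ← Equiv.Perm.mul_apply, ← pow_succ, pow_succ']) x

theorem fix_of_odd {σ τ : Equiv.Perm (Fin N)} (h : ∀ x, τ (σ x) = σ (τ x))
    (hτ : ∀ x, τ (τ x) = x) {x : Fin N} (hx : σ.SameCycle x (τ x))
    (ho : ¬ Even (Function.minimalPeriod σ x)) : τ x = x := by
  obtain ⟨n, hn⟩ := sameCycle_nat hx
  rw [hn, pow_fix_iff]
  have h2 : (σ ^ (n + n)) x = x := by
    rw [pow_add, Equiv.Perm.mul_apply, ← hn, ← comm_pow h, ← hn, hτ]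
  rw [pow_fix_iff, ← two_mul] at h2
  rw [Nat.not_even_iff_odd] at ho
  exact (Nat.Coprime.dvd_of_dvd_mul_left ho.coprime_two_right h2)

theorem half_of_even {σ τ : Equiv.Perm (Fin N)} (h : ∀ x, τ (σ x) = σ (τ x))
    (hτ : ∀ x, τ (τ x) = x) {x : Fin N} (hx : σ.SameCycle x (τ x)) {k : ℕ}
    (he : Function.minimalPeriod σ x = 2 * k) :
    (∀ y, σ.SameCycle x y → τ y = y) ∨ (∀ y, σ.SameCycle x y → τ y = (σ ^ k) y) := by
  obtain ⟨n, hn⟩ := sameCycle_nat hx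
  have h2 : (σ ^ (n + n)) x = x := by
    rw [pow_add, Equiv.Perm.mul_apply, ← hn, ← comm_pow h, ← hn, hτ]
  rw [pow_fix_iff, ← two_mul, he] at h2
  have h3 : k ∣ n := Nat.dvd_of_mul_dvd_mul_left (by norm_num) h2
  obtain ⟨q, rfl⟩ := h3
  have hc : ∀ y, σ.SameCycle x y → ∃ m, y = (σ ^ m) x ∧ τ y = (σ ^ (m + k * q)) x := by
    intro y hy
    obtain ⟨m, rfl⟩ := sameCycle_nat hy
    exact ⟨m, rfl, by rw [comm_pow h, hn, pow_add, Equiv.Perm.mul_apply]⟩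
  rcases Nat.even_or_odd' q with ⟨r, rfl | rfl⟩
  · left
    intro y hy
    obtain ⟨m, h1, h2⟩ := hc y hy
    rw [h2, h1, pow_eq_iff, he]
    have : m + k * (2 * r) = m + (2 * k) * r := by ring
    rw [this]
    exact Nat.add_mul_mod_self_left _ _ _
  · right
    intro y hy
    obtain ⟨m, h1, h2⟩ := hc y hy
    rw [h2, h1, ← Equiv.Perm.mul_apply, ← pow_add, pow_eq_iff, he]
    have : m + k * (2 * r + 1) = k + m + (2 * k) * r := by ring
    rw [this]
    exact Nat.add_mul_mod_self_left _ _ _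

/-- half rotation of the cycle through `x` -/
noncomputable def halfRot (σ : Equiv.Perm (Fin N)) (x : Fin N) (k : ℕ) : Equiv.Perm (Fin N) :=
  (σ.cycleOf x) ^ k

theorem halfRot_in {σ : Equiv.Perm (Fin N)} {x y : Fin N} (h : σ.SameCycle x y) (k : ℕ) :
    halfRot σ x k y = (σ ^ k) y := by
  rw [halfRot, h.cycleOf_eq, Equiv.Perm.cycleOf_pow_apply_self]

theorem halfRot_out {σ : Equiv.Perm (Fin N)} {x y : Fin N} (h : ¬ σ.SameCycle x y) (k : ℕ) :
    halfRot σ x k y = y := by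
  rw [halfRot]
  exact Equiv.Perm.pow_apply_eq_self_of_apply_eq_self
    (Equiv.Perm.cycleOf_apply_of_not_sameCycle h) k

theorem halfRot_sq {σ : Equiv.Perm (Fin N)} {x : Fin N} {k : ℕ}
    (he : Function.minimalPeriod σ x = 2 * k) : halfRot σ x k * halfRot σ x k = 1 := by
  ext1 y
  rw [Equiv.Perm.mul_apply]
  by_cases h : σ.SameCycle x y
  · have h' : σ.SameCycle x ((σ ^ k) y) := h.trans (sameCycle_pow' _ _ _)
    rw [halfRot_in h, halfRot_in h', ← Equiv.Perm.mul_apply, ← pow_add, Equiv.Perm.one_apply,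
      pow_fix_iff, period_sameCycle h, he, two_mul]
  · rw [halfRot_out h, halfRot_out h, Equiv.Perm.one_apply]

theorem halfRot_comm (σ : Equiv.Perm (Fin N)) (x : Fin N) (k : ℕ) (y : Fin N) :
    halfRot σ x k (σ y) = σ (halfRot σ x k y) := by
  by_cases h : σ.SameCycle x y
  · have h' : σ.SameCycle x (σ y) := Equiv.Perm.sameCycle_apply_right.2 h
    rw [halfRot_in h, halfRot_in h', ← Equiv.Perm.mul_apply, ← Equiv.Perm.mul_apply, ← pow_succ,
      pow_succ']
  · have h' : ¬ σ.SameCycle x (σ y) := fun h' => h (Equiv.Perm.sameCycle_apply_right.1 h')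
    rw [halfRot_out h, halfRot_out h']

theorem prod_telescope (f : ℕ → ℤ) (hf : ∀ i, f i * f i = 1) (k : ℕ) :
    ∏ i ∈ Finset.range k, f i * f (i + 1) = f 0 * f k := by
  induction k with
  | zero => simp [hf]
  | succ k ih =>
    rw [Finset.prod_range_succ, ih]
    linear_combination (f 0 * f (k + 1)) * hf k

theorem Ssign_toggle {σ τ : Equiv.Perm (Fin N)} (h : ∀ x, τ (σ x) = σ (τ x))
    (hτ : ∀ x, τ (τ x) = x) {x : Fin N} {k : ℕ}
    (he : Function.minimalPeriod σ x = 2 * k) (hfix : ∀ y, σ.SameCycle x y → τ y = y) :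
    Ssign σ (τ * halfRot σ x k) = - Ssign σ τ := by
  have hk : 0 < k := by have := period_pos σ x; omega
  set τ' := τ * halfRot σ x k with hτ'
  have hin : ∀ y, σ.SameCycle x y → τ' y = (σ ^ k) y := by
    intro y hy
    rw [hτ', Equiv.Perm.mul_apply, halfRot_in hy, hfix _ (hy.trans (sameCycle_pow' _ _ _))]
  have hout : ∀ y, ¬ σ.SameCycle x y → τ' y = τ y := by
    intro y hy
    rw [hτ', Equiv.Perm.mul_apply, halfRot_out hy]
  have hxτ : ∀ y, ¬ σ.SameCycle x y → ¬ σ.SameCycle x (τ y) := by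
    intro y hy h1
    have := hfix _ h1
    rw [hτ] at this
    rw [← this] at h1
    exact hy h1
  have hinv : ∀ y, τ' (τ' y) = y := by
    intro y
    by_cases hy : σ.SameCycle x y
    · rw [hin y hy, hin _ (hy.trans (sameCycle_pow' _ _ _)), ← Equiv.Perm.mul_apply, ← pow_add,
        pow_fix_iff, period_sameCycle hy, he, two_mul]
    · rw [hout y hy, hout _ (hxτ y hy), hτ]
  set P := stdP τ with hPdef
  have hP := stdP_transv τ hτ
  set Q := (Finset.range k).image (fun i => (σ ^ i) x) with hQdef
  have hPC : ∀ y ∈ P, ¬ σ.SameCycle x y := fun y hy hc => hP.1 y hy (hfix y hc)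
  have hQC : ∀ y ∈ Q, σ.SameCycle x y := by
    intro y hy
    rw [hQdef, Finset.mem_image] at hy
    obtain ⟨i, _, rfl⟩ := hy
    exact sameCycle_pow' _ _ _
  have hQmem : ∀ j, (σ ^ j) x ∈ Q ↔ j % (2 * k) < k := by
    intro j
    rw [hQdef, Finset.mem_image]
    constructor
    · rintro ⟨i, hi, hij⟩
      rw [Finset.mem_range] at hi
      rw [pow_eq_iff, he] at hij
      have : i % (2 * k) = j % (2 * k) := hij
      rw [← this, Nat.mod_eq_of_lt (by omega)]
      exact hi
    · intro hj
      refine ⟨j % (2 * k), Finset.mem_range.2 hj, ?_⟩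
      rw [pow_eq_iff, he]
      exact Nat.mod_mod _ _
  have hdisj : Disjoint P Q := Finset.disjoint_left.2 fun y h1 h2 => hPC y h1 (hQC y h2)
  have hmod : ∀ j, (k + j) % (2 * k) < k ↔ ¬ (j % (2 * k) < k) := by
    intro j
    have h1 : j % (2 * k) < 2 * k := Nat.mod_lt _ (by omega)
    have h2 : (k + j) % (2 * k) = (k + j % (2 * k)) % (2 * k) := by simp
    rw [h2]
    by_cases h3 : j % (2 * k) < k
    · rw [Nat.mod_eq_of_lt (by omega)]; omega
    · rw [Nat.mod_eq_sub_mod (by omega), Nat.mod_eq_of_lt (by omega)]; omega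
  have htrans : IsTransv τ' (P ∪ Q) := by
    have hQ2 : ∀ y, σ.SameCycle x y → (y ∈ Q ↔ τ' y ∉ Q) := by
      intro y hy
      obtain ⟨j, rfl⟩ := sameCycle_nat hy
      rw [hin _ hy, ← Equiv.Perm.mul_apply, ← pow_add, hQmem, hQmem, hmod, not_not]
    constructor
    · intro y hy
      rcases Finset.mem_union.1 hy with hy | hy
      · rw [hout y (hPC y hy)]; exact hP.1 y hy
      · intro h1
        have := (hQ2 y (hQC y hy)).1 hy
        rw [h1] at this
        exact this hy
    · intro y hy
      by_cases hc : σ.SameCycle x y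
      · have hc' : σ.SameCycle x (τ' y) := by
          rw [hin y hc]; exact hc.trans (sameCycle_pow' _ _ _)
        have h1 : y ∉ P := fun h => hPC _ h hc
        have h2 : τ' y ∉ P := fun h => hPC _ h hc'
        have := hQ2 y hc
        simp only [Finset.mem_union]
        tauto
      · rw [hout y hc] at hy ⊢
        have h1 : y ∉ Q := fun h => hc (hQC _ h)
        have h2 : τ y ∉ Q := fun h => hxτ y hc (hQC _ h)
        have := hP.2 y hy
        simp only [Finset.mem_union]
        tauto
  rw [Ssign_transv σ τ' hinv _ htrans, Finset.prod_union hdisj, Ssign_eq σ τ]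
  have e1 : ∏ y ∈ P, ori y (τ' y) * ori (σ y) (σ (τ' y)) =
      ∏ y ∈ stdP τ, ori y (τ y) * ori (σ y) (σ (τ y)) :=
    Finset.prod_congr rfl fun y hy => by rw [hout y (hPC y hy)]
  have e2 : ∏ y ∈ Q, ori y (τ' y) * ori (σ y) (σ (τ' y)) = -1 := by
    rw [hQdef, Finset.prod_image]
    · have e3 : ∀ i ∈ Finset.range k, ori ((σ ^ i) x) (τ' ((σ ^ i) x)) *
          ori (σ ((σ ^ i) x)) (σ (τ' ((σ ^ i) x))) =
          (fun i => ori ((σ ^ i) x) ((σ ^ (i + k)) x)) i *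
          (fun i => ori ((σ ^ i) x) ((σ ^ (i + k)) x)) (i + 1) := by
        intro i _
        rw [hin _ (sameCycle_pow' _ _ _)]
        simp only [← Equiv.Perm.mul_apply, ← pow_add, ← pow_succ']
        rw [Nat.add_comm k i, Nat.add_right_comm i 1 k]
      rw [Finset.prod_congr rfl e3, prod_telescope _ (fun i => ori_sq _ _)]
      have e4 : (σ ^ (k + k)) x = x := by rw [pow_fix_iff, he, two_mul]
      have hne : x ≠ (σ ^ k) x := by
        intro h1
        have := (pow_fix_iff σ x k).1 h1.symm
        rw [he] at this
        have := Nat.le_of_dvd hk this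
        omega
      simp only [e4, pow_zero, Equiv.Perm.one_apply, zero_add]
      rw [ori_swap hne, mul_neg, ori_sq]
    · intro i hi j hj hij
      have hi' := Finset.mem_range.1 hi
      have hj' := Finset.mem_range.1 hj
      have hij' : (σ ^ i) x = (σ ^ j) x := hij
      rw [pow_eq_iff, he] at hij'
      have h5 : i % (2 * k) = j % (2 * k) := hij'
      rwa [Nat.mod_eq_of_lt (by omega), Nat.mod_eq_of_lt (by omega)] at h5
  rw [e1, e2]
  ring

/-- points on even cycles of `σ` preserved by `τ` -/
noncomputable def evenInv (σ τ : Equiv.Perm (Fin N)) : Finset (Fin N) := by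
  classical
  exact Finset.univ.filter fun x => Even (Function.minimalPeriod σ x) ∧ σ.SameCycle x (τ x)

theorem mem_evenInv {σ τ : Equiv.Perm (Fin N)} {x : Fin N} : x ∈ evenInv σ τ ↔
    Even (Function.minimalPeriod σ x) ∧ σ.SameCycle x (τ x) := by
  simp [evenInv]

theorem mem_commInv {σ τ : Equiv.Perm (Fin N)} :
    τ ∈ commInv σ ↔ (∀ x, τ (τ x) = x) ∧ (∀ x, τ (σ x) = σ (τ x)) := by
  simp only [commInv, Finset.mem_filter, Finset.mem_univ, true_and]
  constructor
  · rintro ⟨h1, h2⟩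
    exact ⟨fun x => congrArg (fun p : Equiv.Perm (Fin N) => p x) h1,
      fun x => congrArg (fun p : Equiv.Perm (Fin N) => p x) h2.symm⟩
  · rintro ⟨h1, h2⟩
    exact ⟨Equiv.ext h1, Commute.symm (Equiv.ext h2)⟩

theorem toggle_facts {σ τ : Equiv.Perm (Fin N)} (hτ : τ ∈ commInv σ) {x : Fin N}
    (hx : x ∈ evenInv σ τ) {k : ℕ} (he : Function.minimalPeriod σ x = 2 * k) :
    τ * halfRot σ x k ∈ commInv σ ∧ evenInv σ (τ * halfRot σ x k) = evenInv σ τ ∧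
    Ssign σ τ + Ssign σ (τ * halfRot σ x k) = 0 := by
  obtain ⟨h1, h2⟩ := mem_commInv.1 hτ
  obtain ⟨_, hx2⟩ := mem_evenInv.1 hx
  have hkk : ∀ y, σ.SameCycle x y → (σ ^ k) ((σ ^ k) y) = y := by
    intro y hy
    rw [← Equiv.Perm.mul_apply, ← pow_add,
        pow_fix_iff, period_sameCycle hy, he, two_mul]
  have hxτ : ∀ y, σ.SameCycle x y → σ.SameCycle x (τ y) := fun y hy =>
    hx2.trans (sameCycle_comm h2 hy)
  have hxτ' : ∀ y, ¬ σ.SameCycle x y → ¬ σ.SameCycle x (τ y) := by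
    intro y hy h
    have := hxτ _ h
    rw [h1] at this
    exact hy this
  have hcomm : ∀ y, (τ * halfRot σ x k) (σ y) = σ ((τ * halfRot σ x k) y) := by
    intro y
    simp only [Equiv.Perm.mul_apply, halfRot_comm, h2]
  have hτh : ∀ y, τ (halfRot σ x k y) = halfRot σ x k (τ y) := by
    intro y
    by_cases hy : σ.SameCycle x y
    · rw [halfRot_in hy, halfRot_in (hxτ y hy), comm_pow h2]
    · rw [halfRot_out hy, halfRot_out (hxτ' y hy)]
  have hhh : ∀ y, halfRot σ x k (halfRot σ x k y) = y := fun y =>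
    congrArg (fun p : Equiv.Perm (Fin N) => p y) (halfRot_sq he)
  have hinv : ∀ y, (τ * halfRot σ x k) ((τ * halfRot σ x k) y) = y := by
    intro y
    simp only [Equiv.Perm.mul_apply, hτh, hhh, h1]
  refine ⟨mem_commInv.2 ⟨hinv, hcomm⟩, ?_, ?_⟩
  · ext y
    rw [mem_evenInv, mem_evenInv, Equiv.Perm.mul_apply]
    by_cases hy : σ.SameCycle x y
    · rw [halfRot_in hy, comm_pow h2]
      have : σ.SameCycle (τ y) ((σ ^ k) (τ y)) := sameCycle_pow' _ _ _
      exact ⟨fun h => ⟨h.1, h.2.trans this.symm⟩, fun h => ⟨h.1, h.2.trans this⟩⟩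
    · rw [halfRot_out hy]
  · rcases half_of_even h2 h1 hx2 he with h | h
    · rw [Ssign_toggle h2 h1 he h]; ring
    · have h3 : ∀ y, σ.SameCycle x y → (τ * halfRot σ x k) y = y := by
        intro y hy
        rw [Equiv.Perm.mul_apply, hτh, halfRot_in (hxτ y hy), h y hy, hkk y hy]
      have := Ssign_toggle hcomm hinv he h3
      rw [mul_assoc, halfRot_sq he, mul_one] at this
      rw [this]; ring

theorem sum_bad (σ : Equiv.Perm (Fin N)) :
    ∑ τ ∈ (commInv σ).filter (fun τ => (evenInv σ τ).Nonempty), Ssign σ τ = 0 := by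
  have hm : ∀ τ (h : (evenInv σ τ).Nonempty), Function.minimalPeriod σ ((evenInv σ τ).min' h) =
      2 * (Function.minimalPeriod σ ((evenInv σ τ).min' h) / 2) := by
    intro τ h
    have := (mem_evenInv.1 ((evenInv σ τ).min'_mem h)).1
    exact (Nat.two_mul_div_two_of_even this).symm
  refine Finset.sum_involution (fun τ hτ => τ * halfRot σ
      ((evenInv σ τ).min' (Finset.mem_filter.1 hτ).2)
      (Function.minimalPeriod σ ((evenInv σ τ).min' (Finset.mem_filter.1 hτ).2) / 2))
      ?_ ?_ ?_ ?_
  · intro τ hτ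
    rw [Finset.mem_filter] at hτ
    exact (toggle_facts hτ.1 ((evenInv σ τ).min'_mem hτ.2) (hm τ hτ.2)).2.2
  · intro τ hτ h0 heq
    rw [Finset.mem_filter] at hτ
    have := (toggle_facts hτ.1 ((evenInv σ τ).min'_mem hτ.2) (hm τ hτ.2)).2.2
    rw [heq] at this
    omega
  · intro τ hτ
    rw [Finset.mem_filter] at hτ ⊢
    have := (toggle_facts hτ.1 ((evenInv σ τ).min'_mem hτ.2) (hm τ hτ.2))
    refine ⟨this.1, ?_⟩
    rw [this.2.1]
    exact hτ.2
  · intro τ hτ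
    have hτ' := Finset.mem_filter.1 hτ
    have := (toggle_facts hτ'.1 ((evenInv σ τ).min'_mem hτ'.2) (hm τ hτ'.2))
    simp only [this.2.1]
    rw [mul_assoc, halfRot_sq (hm τ hτ'.2), mul_one]

/-- A label for the cycle of `σ` through `x`. -/
noncomputable def cyc (σ : Equiv.Perm (Fin N)) (x : Fin N) : Fin N :=
  (Quotient.mk (Equiv.Perm.SameCycle.setoid σ) x).out

theorem cyc_eq {σ : Equiv.Perm (Fin N)} {x y : Fin N} : cyc σ x = cyc σ y ↔ σ.SameCycle x y := by
  unfold cyc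
  constructor
  · intro h
    have h2 := Quotient.out_injective h
    exact Quotient.exact h2
  · intro h
    have : Quotient.mk (Equiv.Perm.SameCycle.setoid σ) x =
      Quotient.mk (Equiv.Perm.SameCycle.setoid σ) y := Quotient.sound h
    rw [this]

theorem cyc_apply (σ : Equiv.Perm (Fin N)) (x : Fin N) : cyc σ (σ x) = cyc σ x := by
  rw [cyc_eq]; exact ⟨-1, by simp⟩

theorem good_fix {σ τ : Equiv.Perm (Fin N)} (hτ : τ ∈ commInv σ)
    (hg : ¬ (evenInv σ τ).Nonempty) {x : Fin N} (h : cyc σ x = cyc σ (τ x)) :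
    τ x = x ∧ ¬ Even (Function.minimalPeriod σ x) := by
  rw [cyc_eq] at h
  obtain ⟨h1, h2⟩ := mem_commInv.1 hτ
  have : ¬ Even (Function.minimalPeriod σ x) := fun he => hg ⟨x, mem_evenInv.2 ⟨he, h⟩⟩
  exact ⟨fix_of_odd h2 h1 h this, this⟩

theorem Ssign_good {σ τ : Equiv.Perm (Fin N)} (hτ : τ ∈ commInv σ)
    (hg : ¬ (evenInv σ τ).Nonempty) : Ssign σ τ = 1 := by
  obtain ⟨h1, h2⟩ := mem_commInv.1 hτ
  set P : Finset (Fin N) := Finset.univ.filter fun x => cyc σ x < cyc σ (τ x) with hP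
  have hPm : ∀ x, x ∈ P ↔ cyc σ x < cyc σ (τ x) := by intro x; simp [hP]
  have hT : IsTransv τ P := by
    constructor
    · intro x hx h
      rw [hPm, h] at hx
      exact lt_irrefl _ hx
    · intro x hx
      rw [hPm, hPm, h1, not_lt]
      refine ⟨fun h => h.le, fun h => lt_of_le_of_ne h fun h' => hx (good_fix hτ hg h').1⟩
  rw [Ssign_transv σ τ h1 P hT, Finset.prod_mul_distrib]
  have e : ∏ x ∈ P, ori (σ x) (σ (τ x)) = ∏ x ∈ P, ori x (τ x) := by
    refine Finset.prod_bij (fun x _ => σ x) ?_ ?_ ?_ ?_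
    · intro x hx
      rw [hPm] at hx ⊢
      rwa [h2, cyc_apply, cyc_apply]
    · intro x _ y _ h; exact σ.injective h
    · intro y hy
      refine ⟨σ⁻¹ y, ?_, by simp⟩
      rw [hPm] at hy ⊢
      have e1 : cyc σ (σ⁻¹ y) = cyc σ y := by
        rw [← cyc_apply]; simp
      have e2 : cyc σ (τ (σ⁻¹ y)) = cyc σ (τ y) := by
        rw [← cyc_apply, ← h2]; simp
      rwa [e1, e2]
    · intro x _
      rw [h2]
  rw [e, ← Finset.prod_mul_distrib]
  exact Finset.prod_eq_one fun x _ => ori_sq _ _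

end cyc

theorem partition_surj {α : Type*} [Fintype α] [DecidableEq α] :
    Function.Surjective (Equiv.Perm.partition : Equiv.Perm α → (Fintype.card α).Partition) := by
  intro p
  have hsum := p.parts_sum
  have hsplit : p.parts.filter (fun n => 2 ≤ n) + p.parts.filter (fun n => ¬ 2 ≤ n) = p.parts :=
    Multiset.filter_add_not _ _
  have hone : p.parts.filter (fun n => ¬ 2 ≤ n)
      = Multiset.replicate (Multiset.card (p.parts.filter (fun n => ¬ 2 ≤ n))) 1 := by
    rw [Multiset.eq_replicate]
    refine ⟨rfl, fun b hb => ?_⟩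
    rw [Multiset.mem_filter] at hb
    have := p.parts_pos hb.1
    omega
  have hs2 : (p.parts.filter (fun n => 2 ≤ n)).sum
      + Multiset.card (p.parts.filter (fun n => ¬ 2 ≤ n)) = Fintype.card α := by
    have h3 := congrArg Multiset.sum hsplit
    have h4 := congrArg Multiset.sum hone
    rw [Multiset.sum_add] at h3
    rw [Multiset.sum_replicate, smul_eq_mul, mul_one] at h4
    omega
  obtain ⟨g, hg⟩ := (Equiv.Perm.exists_with_cycleType_iff α
    (m := p.parts.filter (fun n => 2 ≤ n))).2 ⟨by omega, by
      intro a ha; exact (Multiset.mem_filter.1 ha).2⟩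
  refine ⟨g, ?_⟩
  rw [Nat.Partition.ext_iff, Equiv.Perm.parts_partition, ← Equiv.Perm.sum_cycleType, hg]
  refine Eq.trans ?_ hsplit
  congr 1
  rw [hone]
  congr 1
  omega

theorem card_conjClasses_perm (N : ℕ) :
    Nat.card (ConjClasses (Equiv.Perm (Fin N))) = Fintype.card (Nat.Partition N) := by
  have e : Nat.card (ConjClasses (Equiv.Perm (Fin N))) =
      Nat.card (Nat.Partition (Fintype.card (Fin N))) := by
    refine Nat.card_congr (Equiv.ofBijective (Quotient.lift Equiv.Perm.partition
      fun a b h => Equiv.Perm.partition_eq_of_isConj.1 h) ⟨?_, ?_⟩)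
    · intro a b
      refine Quotient.inductionOn₂ a b fun a b h => ?_
      exact Quotient.sound (Equiv.Perm.partition_eq_of_isConj.2 h)
    · intro p
      obtain ⟨g, hg⟩ := partition_surj p
      exact ⟨Quotient.mk _ g, hg⟩
  rw [e, Fintype.card_fin, Nat.card_eq_fintype_card]

/-- The square roots of `σ`. -/
def sqRoots {N : ℕ} (σ : Equiv.Perm (Fin N)) : Finset (Equiv.Perm (Fin N)) :=
  Finset.univ.filter fun ρ => ρ * ρ = σ

theorem card_sqRoots_inv {N : ℕ} (σ : Equiv.Perm (Fin N)) :
    (sqRoots σ⁻¹).card = (sqRoots σ).card := by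
  refine Finset.card_nbij' (fun ρ => ρ⁻¹) (fun ρ => ρ⁻¹) ?_ ?_ ?_ ?_
  · intro ρ h
    simp only [sqRoots, Finset.coe_filter, Finset.mem_univ, true_and, Set.mem_ofPred_eq] at h ⊢
    rw [← mul_inv_rev, h, inv_inv]
  · intro ρ h
    simp only [sqRoots, Finset.coe_filter, Finset.mem_univ, true_and, Set.mem_ofPred_eq] at h ⊢
    rw [← mul_inv_rev, h]
  · intro ρ _; simp
  · intro ρ _; simp

theorem sum_sqRoots_sq (N : ℕ) :
    ∑ σ : Equiv.Perm (Fin N), (sqRoots σ).card * (sqRoots σ).card =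
      Nat.card (ConjClasses (Equiv.Perm (Fin N))) * Nat.card (Equiv.Perm (Fin N)) := by
  classical
  rw [← card_comm_eq_card_conjClasses_mul_card]
  have hconj : ∀ c : Equiv.Perm (Fin N), ∃ t : Equiv.Perm (Fin N), t * c * t⁻¹ = c⁻¹ := by
    intro c
    have : IsConj c c⁻¹ := by
      rw [Equiv.Perm.isConj_iff_cycleType_eq, Equiv.Perm.cycleType_inv]
    exact isConj_iff.1 this
  choose t ht using hconj
  have h1 : ∑ σ : Equiv.Perm (Fin N), (sqRoots σ).card * (sqRoots σ).card =
      ((Finset.univ : Finset (Equiv.Perm (Fin N))).sigma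
        fun σ => sqRoots σ ×ˢ sqRoots σ).card := by
    rw [Finset.card_sigma]
    simp
  rw [h1, Nat.card_eq_fintype_card, Fintype.card_subtype]
  -- (a, b) with a² = b², put c = a b⁻¹, then b c b⁻¹ = c⁻¹, and b = t_c d with d commuting with c
  have key : ∀ c b : Equiv.Perm (Fin N), c * b * (c * b) = b * b ↔ Commute c ((t c)⁻¹ * b) := by
    intro c b
    have hc := ht c
    have hc' : t c * c = c⁻¹ * t c := by rw [← hc]; group
    have hc2 : c * (t c)⁻¹ = (t c)⁻¹ * c⁻¹ := by
      rw [← hc]; group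
    rw [commute_iff_eq, ← mul_assoc c (t c)⁻¹ b, hc2]
    constructor
    · intro h
      have : c * b * c = b := by
        have h2 : c * b * c * b = b * b := by rw [← h]; group
        exact mul_right_cancel h2
      calc (t c)⁻¹ * c⁻¹ * b = (t c)⁻¹ * c⁻¹ * (c * b * c) := by rw [this]
        _ = _ := by group
    · intro h
      have h2 : c⁻¹ * b = b * c := by
        have := congrArg (fun z => t c * z) h
        simpa [mul_assoc] using this
      calc c * b * (c * b) = c * (b * c) * b := by group
        _ = b * b := by rw [← h2]; group
  refine Finset.card_bij' (fun x _ => (x.2.1 * x.2.2⁻¹, (t (x.2.1 * x.2.2⁻¹))⁻¹ * x.2.2))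
    (fun p _ => ⟨(t p.1 * p.2) * (t p.1 * p.2), (p.1 * (t p.1 * p.2), t p.1 * p.2)⟩) ?_ ?_ ?_ ?_
  · rintro ⟨σ, a, b⟩ h
    simp only [sqRoots, Finset.mem_sigma, Finset.mem_product, Finset.mem_filter, Finset.mem_univ,
      true_and] at h ⊢
    rw [← key]
    simp [h.1, h.2]
  · rintro ⟨c, d⟩ h
    simp only [sqRoots, Finset.mem_sigma, Finset.mem_product, Finset.mem_filter, Finset.mem_univ,
      true_and] at h ⊢
    refine ⟨?_, trivial⟩
    rw [key]
    simpa using h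
  · rintro ⟨σ, a, b⟩ h
    simp only [sqRoots, Finset.mem_sigma, Finset.mem_product, Finset.mem_filter, Finset.mem_univ,
      true_and] at h
    obtain ⟨h1, h2⟩ := h
    subst h2
    simp
  · rintro ⟨c, d⟩ h
    have e : c * (t c * d) * (t c * d)⁻¹ = c := by group
    simp only [e]
    simp

section bij
variable {N : ℕ}

open Classical in
/-- the square root attached to an involution -/
noncomputable def rootFun (σ τ : Equiv.Perm (Fin N)) (x : Fin N) : Fin N :=
  if cyc σ x < cyc σ (τ x) then τ x else
  if cyc σ (τ x) < cyc σ x then τ (σ x) else (σ ^ ((Function.minimalPeriod σ x + 1) / 2)) x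

theorem rootFun_lt {σ τ : Equiv.Perm (Fin N)} {x : Fin N} (h : cyc σ x < cyc σ (τ x)) :
    rootFun σ τ x = τ x := by rw [rootFun, if_pos h]

theorem rootFun_gt {σ τ : Equiv.Perm (Fin N)} {x : Fin N} (h : cyc σ (τ x) < cyc σ x) :
    rootFun σ τ x = τ (σ x) := by rw [rootFun, if_neg h.not_gt, if_pos h]

theorem rootFun_eq {σ τ : Equiv.Perm (Fin N)} {x : Fin N} (h : cyc σ x = cyc σ (τ x)) :
    rootFun σ τ x = (σ ^ ((Function.minimalPeriod σ x + 1) / 2)) x := by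
  rw [rootFun, if_neg h.not_lt, if_neg h.not_gt]

open Classical in
/-- the involution attached to a square root -/
noncomputable def invFun' (σ ρ : Equiv.Perm (Fin N)) (x : Fin N) : Fin N :=
  if cyc σ x < cyc σ (ρ x) then ρ x else
  if cyc σ (ρ x) < cyc σ x then ρ⁻¹ x else x

theorem invFun'_lt {σ τ : Equiv.Perm (Fin N)} {x : Fin N} (h : cyc σ x < cyc σ (τ x)) :
    invFun' σ τ x = τ x := by rw [invFun', if_pos h]

theorem invFun'_gt {σ τ : Equiv.Perm (Fin N)} {x : Fin N} (h : cyc σ (τ x) < cyc σ x) :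
    invFun' σ τ x = τ⁻¹ x := by rw [invFun', if_neg h.not_gt, if_pos h]

theorem invFun'_eq {σ τ : Equiv.Perm (Fin N)} {x : Fin N} (h : cyc σ x = cyc σ (τ x)) :
    invFun' σ τ x = x := by
  rw [invFun', if_neg h.not_lt, if_neg h.not_gt]

theorem rootFun_sq {σ τ : Equiv.Perm (Fin N)} (hτ : τ ∈ commInv σ)
    (hg : ¬ (evenInv σ τ).Nonempty) (x : Fin N) : rootFun σ τ (rootFun σ τ x) = σ x := by
  obtain ⟨h1, h2⟩ := mem_commInv.1 hτ
  rcases lt_trichotomy (cyc σ x) (cyc σ (τ x)) with h | h | h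
  · rw [rootFun_lt h, rootFun_gt (by rwa [h1]), h2, h1]
  · obtain ⟨hf, ho⟩ := good_fix hτ hg h
    rw [rootFun_eq h]
    have hs := sameCycle_pow' σ x ((Function.minimalPeriod σ x + 1) / 2)
    have h3 : τ ((σ ^ ((Function.minimalPeriod σ x + 1) / 2)) x) =
      ((σ ^ ((Function.minimalPeriod σ x + 1) / 2)) x) := by rw [comm_pow h2, hf]
    rw [rootFun_eq (by rw [h3]), period_sameCycle hs, ← Equiv.Perm.mul_apply, ← pow_add]
    have h4 : (Function.minimalPeriod σ x + 1) / 2 + (Function.minimalPeriod σ x + 1) / 2 =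
        1 + Function.minimalPeriod σ x := by
      rw [Nat.not_even_iff_odd] at ho
      obtain ⟨r, hr⟩ := ho
      omega
    rw [h4, pow_add, Equiv.Perm.mul_apply, (pow_fix_iff σ x _).2 dvd_rfl, pow_one]
  · rw [rootFun_gt h, rootFun_lt, h1]
    rw [h1, cyc_apply, h2, cyc_apply]
    exact h

noncomputable def rootPerm (σ τ : Equiv.Perm (Fin N)) (hτ : τ ∈ commInv σ)
    (hg : ¬ (evenInv σ τ).Nonempty) : Equiv.Perm (Fin N) :=
  Equiv.ofBijective (rootFun σ τ) (by
    rw [← Finite.injective_iff_bijective]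
    intro x y h
    apply σ.injective
    rw [← rootFun_sq hτ hg, h, rootFun_sq hτ hg])

theorem rootPerm_apply (σ τ : Equiv.Perm (Fin N)) (hτ : τ ∈ commInv σ)
    (hg : ¬ (evenInv σ τ).Nonempty) (x : Fin N) : rootPerm σ τ hτ hg x = rootFun σ τ x := rfl

theorem root_comm {σ ρ : Equiv.Perm (Fin N)} (h : ∀ x, ρ (ρ x) = σ x) (x : Fin N) :
    ρ (σ x) = σ (ρ x) := by rw [← h, ← h]

theorem root_inv {σ ρ : Equiv.Perm (Fin N)} (h : ∀ x, ρ (ρ x) = σ x) (x : Fin N) :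
    cyc σ (ρ⁻¹ x) = cyc σ (ρ x) := by
  rw [← cyc_apply, ← h]
  simp

theorem root_inv_apply {σ ρ : Equiv.Perm (Fin N)} (h : ∀ x, ρ (ρ x) = σ x) (x : Fin N) :
    ρ⁻¹ (σ x) = ρ x := by
  rw [← h]; simp

theorem invFun'_invol {σ ρ : Equiv.Perm (Fin N)} (h : ∀ x, ρ (ρ x) = σ x) (x : Fin N) :
    invFun' σ ρ (invFun' σ ρ x) = x := by
  rcases lt_trichotomy (cyc σ x) (cyc σ (ρ x)) with hx | hx | hx
  · rw [invFun'_lt hx, invFun'_gt]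
    · simp
    · rwa [h, cyc_apply]
  · rw [invFun'_eq hx, invFun'_eq hx]
  · rw [invFun'_gt hx, invFun'_lt]
    · simp
    · rw [root_inv h]
      simpa using hx

theorem invFun'_comm {σ ρ : Equiv.Perm (Fin N)} (h : ∀ x, ρ (ρ x) = σ x) (x : Fin N) :
    invFun' σ ρ (σ x) = σ (invFun' σ ρ x) := by
  have e : cyc σ (ρ (σ x)) = cyc σ (ρ x) := by rw [root_comm h, cyc_apply]
  rcases lt_trichotomy (cyc σ x) (cyc σ (ρ x)) with hx | hx | hx
  · rw [invFun'_lt hx, invFun'_lt, root_comm h]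
    rwa [e, cyc_apply]
  · rw [invFun'_eq hx, invFun'_eq]
    rwa [e, cyc_apply]
  · rw [invFun'_gt hx, invFun'_gt, root_inv_apply h, ← h]
    · simp
    · rwa [e, cyc_apply]

noncomputable def invPerm (σ ρ : Equiv.Perm (Fin N)) (h : ∀ x, ρ (ρ x) = σ x) :
    Equiv.Perm (Fin N) := Function.Involutive.toPerm (invFun' σ ρ) (invFun'_invol h)

theorem invPerm_apply (σ ρ : Equiv.Perm (Fin N)) (h : ∀ x, ρ (ρ x) = σ x) (x : Fin N) :
    invPerm σ ρ h x = invFun' σ ρ x := rfl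

theorem invPerm_mem {σ ρ : Equiv.Perm (Fin N)} (h : ∀ x, ρ (ρ x) = σ x) :
    invPerm σ ρ h ∈ commInv σ :=
  mem_commInv.2 ⟨fun x => invFun'_invol h x, fun x => invFun'_comm h x⟩

theorem root_same {σ ρ : Equiv.Perm (Fin N)} (h : ∀ x, ρ (ρ x) = σ x) {x : Fin N}
    (hx : cyc σ x = cyc σ (ρ x)) : ∃ i, ρ x = (σ ^ i) x ∧
      2 * i ≡ 1 [MOD Function.minimalPeriod σ x] := by
  rw [cyc_eq] at hx
  obtain ⟨i, hi⟩ := sameCycle_nat hx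
  refine ⟨i, hi, ?_⟩
  rw [← pow_eq_iff, two_mul, pow_add, Equiv.Perm.mul_apply, ← hi, ← comm_pow (root_comm h), ← hi, h,
    pow_one]

theorem cyc_invFun' {σ ρ : Equiv.Perm (Fin N)} (h : ∀ x, ρ (ρ x) = σ x) (x : Fin N) :
    cyc σ (invFun' σ ρ x) = cyc σ (ρ x) := by
  rcases lt_trichotomy (cyc σ x) (cyc σ (ρ x)) with hx | hx | hx
  · rw [invFun'_lt hx]
  · rw [invFun'_eq hx, hx]
  · rw [invFun'_gt hx, root_inv h]

theorem root_same_odd {σ ρ : Equiv.Perm (Fin N)} (h : ∀ x, ρ (ρ x) = σ x) {x : Fin N}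
    (hx : cyc σ x = cyc σ (ρ x)) : ¬ Even (Function.minimalPeriod σ x) := by
  obtain ⟨i, _, hi⟩ := root_same h hx
  intro he
  have h2 : 2 * i ≡ 1 [MOD 2] := hi.of_dvd he.two_dvd
  unfold Nat.ModEq at h2
  omega

theorem invPerm_good {σ ρ : Equiv.Perm (Fin N)} (h : ∀ x, ρ (ρ x) = σ x) :
    ¬ (evenInv σ (invPerm σ ρ h)).Nonempty := by
  rintro ⟨x, hx⟩
  rw [mem_evenInv, ← cyc_eq, invPerm_apply, cyc_invFun' h] at hx
  exact root_same_odd h hx.2 hx.1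

theorem cyc_rootFun {σ τ : Equiv.Perm (Fin N)} (hτ : τ ∈ commInv σ) (x : Fin N) :
    cyc σ (rootFun σ τ x) = cyc σ (τ x) := by
  obtain ⟨h1, h2⟩ := mem_commInv.1 hτ
  rcases lt_trichotomy (cyc σ x) (cyc σ (τ x)) with hx | hx | hx
  · rw [rootFun_lt hx]
  · rw [rootFun_eq hx, ← hx, eq_comm, cyc_eq]
    exact sameCycle_pow' _ _ _
  · rw [rootFun_gt hx, h2, cyc_apply]

theorem card_good (σ : Equiv.Perm (Fin N)) :
    ((commInv σ).filter (fun τ => ¬ (evenInv σ τ).Nonempty)).card = (sqRoots σ).card := by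
  have hr : ∀ ρ : Equiv.Perm (Fin N), ρ ∈ sqRoots σ ↔ ∀ x, ρ (ρ x) = σ x := by
    intro ρ
    simp only [sqRoots, Finset.mem_filter, Finset.mem_univ, true_and]
    exact ⟨fun h x => congrArg (fun p : Equiv.Perm (Fin N) => p x) h, fun h => Equiv.ext h⟩
  refine Finset.card_bij'
    (fun τ hτ => rootPerm σ τ (Finset.mem_filter.1 hτ).1 (Finset.mem_filter.1 hτ).2)
    (fun ρ hρ => invPerm σ ρ ((hr ρ).1 hρ)) ?_ ?_ ?_ ?_
  · intro τ hτ
    rw [Finset.mem_filter] at hτ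
    rw [hr]
    exact fun x => rootFun_sq hτ.1 hτ.2 x
  · intro ρ hρ
    rw [hr] at hρ
    rw [Finset.mem_filter]
    exact ⟨invPerm_mem hρ, invPerm_good hρ⟩
  · intro τ hτ
    obtain ⟨ht, hg⟩ := Finset.mem_filter.1 hτ
    obtain ⟨h1, h2⟩ := mem_commInv.1 ht
    ext1 x
    rw [invPerm_apply]
    have hc : cyc σ (rootPerm σ τ ht hg x) = cyc σ (τ x) := cyc_rootFun ht x
    rcases lt_trichotomy (cyc σ x) (cyc σ (τ x)) with hx | hx | hx
    · rw [invFun'_lt (by rwa [hc]), rootPerm_apply, rootFun_lt hx]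
    · rw [invFun'_eq (by rwa [hc]), (good_fix ht hg hx).1]
    · rw [invFun'_gt (by rwa [hc]), Equiv.Perm.inv_eq_iff_eq, rootPerm_apply, rootFun_lt, h1]
      rwa [h1]
  · intro ρ hρ
    have h := (hr ρ).1 hρ
    ext1 x
    rw [rootPerm_apply]
    have hc : cyc σ (invPerm σ ρ h x) = cyc σ (ρ x) := cyc_invFun' h x
    rcases lt_trichotomy (cyc σ x) (cyc σ (ρ x)) with hx | hx | hx
    · rw [rootFun_lt (by rwa [hc]), invPerm_apply, invFun'_lt hx]
    · rw [rootFun_eq (by rwa [hc])]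
      obtain ⟨i, hi, hi2⟩ := root_same h hx
      have ho := root_same_odd h hx
      rw [Nat.not_even_iff_odd] at ho
      rw [hi, pow_eq_iff]
      refine Nat.ModEq.cancel_left_of_coprime (c := 2) ho.coprime_two_right ?_
      refine Nat.ModEq.trans ?_ hi2.symm
      obtain ⟨r, hr⟩ := ho
      have : 2 * ((Function.minimalPeriod σ x + 1) / 2) = 1 + Function.minimalPeriod σ x := by omega
      rw [this]
      exact Nat.add_mod_right _ _
    · rw [rootFun_gt (by rwa [hc]), invPerm_apply, invFun'_gt, root_inv_apply h]
      rwa [root_comm h, cyc_apply, cyc_apply]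

theorem sum_Ssign (σ : Equiv.Perm (Fin N)) :
    ∑ τ ∈ commInv σ, Ssign σ τ = ((sqRoots σ).card : ℤ) := by
  rw [← Finset.sum_filter_add_sum_filter_not (commInv σ) (fun τ => (evenInv σ τ).Nonempty),
    sum_bad, zero_add, ← card_good, Finset.sum_congr rfl (g := fun _ => (1 : ℤ))]
  · simp
  · intro τ hτ
    rw [Finset.mem_filter] at hτ
    exact Ssign_good hτ.1 hτ.2

end bij

theorem EndGA_eq (N : ℕ) : EndGA N = (Representation.linHom (repA N) (repA N)).invariants := by
  ext T
  rw [Representation.mem_invariants]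
  change (∀ σ, T ∘ₗ piRepA N σ = piRepA N σ ∘ₗ T) ↔
    ∀ σ, repA N σ ∘ₗ T ∘ₗ repA N σ⁻¹ = T
  have hr : ∀ σ, piRepA N σ = repA N σ := fun _ => rfl
  refine forall_congr' fun σ => ?_
  rw [hr]
  have e1 : repA N σ ∘ₗ repA N σ⁻¹ = LinearMap.id := by
    rw [← Module.End.mul_eq_comp, ← map_mul]; simp; rfl
  have e2 : repA N σ⁻¹ ∘ₗ repA N σ = LinearMap.id := by
    rw [← Module.End.mul_eq_comp, ← map_mul]; simp; rfl
  constructor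
  · intro h
    rw [← LinearMap.comp_assoc, ← h, LinearMap.comp_assoc, e1, LinearMap.comp_id]
  · intro h
    conv_lhs => rw [← h]
    rw [LinearMap.comp_assoc, LinearMap.comp_assoc, e2, LinearMap.comp_id]

/-- The dimension of End_{Σ_N}(A) equals the number of partitions of N. -/
theorem finrank_EndGA (N : ℕ) :
    Module.finrank ℂ (EndGA N) = Fintype.card (Nat.Partition N) := by
  have hG : (Nat.card (Equiv.Perm (Fin N)) : ℂ) ≠ 0 := by
    exact_mod_cast (Nat.card_pos (α := Equiv.Perm (Fin N))).ne'
  haveI : Invertible (Nat.card (Equiv.Perm (Fin N)) : ℂ) := invertibleOfNonzero hG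
  have h := Representation.card_inv_mul_sum_char_eq_finrank
    (Representation.linHom (repA N) (repA N))
  rw [← EndGA_eq] at h
  have h2 : ∑ σ : Equiv.Perm (Fin N), (Representation.linHom (repA N) (repA N)).character σ =
      ((∑ σ : Equiv.Perm (Fin N), (sqRoots σ).card * (sqRoots σ).card : ℕ) : ℂ) := by
    rw [Nat.cast_sum]
    refine Finset.sum_congr rfl fun σ _ => ?_
    rw [Representation.char_linHom, char_repA, char_repA, sum_Ssign, sum_Ssign, card_sqRoots_inv]
    push_cast
    rfl
  rw [h2, sum_sqRoots_sq, Nat.cast_mul, mul_comm (Nat.card (ConjClasses _) : ℂ),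
    inv_mul_cancel_left₀ hG, card_conjClasses_perm] at h
  exact_mod_cast h.symm
end
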